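/- arXiv:1604.07035 — 10 statements merged into one kernel-verified Lean document; each statement's English description precedes it below -/
import Mathlib

section
/- Let H be an inclusion-free hypergraph on vertex set [n], let f: [M] → ℝ be a strictly increasing function with strictly positive values, and let w: [n] → [M] be a weight with w(i) ≥ 2 for all i ∈ [n]. If e ∈ H is a min-weight edge for w (i.e. fw(e) ≤ fw(e') for all e' ∈ H), then the weight w − χ_e (where χ_e is the characteristic function of e) is isolating for H and f, and e is its unique min-weight edge. -/
open Finset

/-- The weight of an edge `e` under vertex-weight function `w` and objective function `f`:
`fw(e) = ∑_{i ∈ e} f(w(i))`. -/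
def edgeW {V : Type*} (f : ℕ → ℝ) (w : V → ℕ) (e : Finset V) : ℝ :=
  ∑ i ∈ e, f (w i)

/-- A hypergraph is inclusion-free if no edge is a proper subset of another edge. -/
def InclFree {V : Type*} (H : Finset (Finset V)) : Prop :=
  ∀ e ∈ H, ∀ e' ∈ H, ¬ e ⊂ e'

/-- `f` is an objective function for `[M]`: strictly increasing with strictly positive
values on `{1, …, M}`. -/
def Objective (M : ℕ) (f : ℕ → ℝ) : Prop :=
  StrictMonoOn f (Set.Icc 1 M) ∧ ∀ i ∈ Set.Icc 1 M, (0 : ℝ) < f i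

/-- `w` is isolating for `H, f`: there is exactly one edge `e ∈ H` with
`fw(e) < fw(e')` for all edges `e' ≠ e`.  By convention every weight is isolating
for the empty hypergraph. -/
def Isolating {V : Type*} (H : Finset (Finset V)) (f : ℕ → ℝ) (w : V → ℕ) : Prop :=
  H = ∅ ∨ ∃! e, e ∈ H ∧ ∀ e' ∈ H, e' ≠ e → edgeW f w e < edgeW f w e'

/-- `Z(H, M, f)`: the set of isolating weights `w : V → {1, …, M}`. -/
def Zset {V : Type*} (M : ℕ) (H : Finset (Finset V)) (f : ℕ → ℝ) : Set (V → ℕ) :=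
  {w | (∀ i, 1 ≤ w i ∧ w i ≤ M) ∧ Isolating H f w}

/-- `Z_j(H, M, f)`: the set of isolating weights `w ∈ [M]^V` whose minimum entry
(layer) equals `j`. -/
def Zlayer {V : Type*} (M j : ℕ) (H : Finset (Finset V)) (f : ℕ → ℝ) : Set (V → ℕ) :=
  {w | w ∈ Zset M H f ∧ (∀ i, j ≤ w i) ∧ ∃ i, w i = j}

/-- Lowering the weight by one on `e` decreases the weight of an edge `s` by the sum of the
decrements of `f` over `s ∩ e`. -/
lemma edgeW_sub_indicator {V : Type*} [DecidableEq V] (f : ℕ → ℝ) (w : V → ℕ) (e s : Finset V) :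
    edgeW f (fun i => if i ∈ e then w i - 1 else w i) s =
      edgeW f w s - ∑ i ∈ s ∩ e, (f (w i) - f (w i - 1)) := by
  unfold edgeW
  rw [← Finset.sum_ite_mem, ← Finset.sum_sub_distrib]
  refine Finset.sum_congr rfl fun i _ => ?_
  by_cases hi : i ∈ e <;> simp [hi]

/-- Proposition 1 of the paper.  If `H` is inclusion-free,
`f` an objective function, `w : [n] → {2, …, M}`, and `e ∈ H` is a min-weight
edge for `w`, then `w - χ_e` is isolating for `H, f` and `e` is its unique
min-weight edge. -/
theorem stmt_0 {n M : ℕ} (H : Finset (Finset (Fin n))) (f : ℕ → ℝ)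
    (hH : InclFree H) (hf : Objective M f)
    (w : Fin n → ℕ) (hw : ∀ i, 2 ≤ w i ∧ w i ≤ M)
    (e : Finset (Fin n)) (he : e ∈ H)
    (hmin : ∀ e' ∈ H, edgeW f w e ≤ edgeW f w e') :
    (∀ e' ∈ H, e' ≠ e →
        edgeW f (fun i => if i ∈ e then w i - 1 else w i) e <
          edgeW f (fun i => if i ∈ e then w i - 1 else w i) e') ∧
      Isolating H f (fun i => if i ∈ e then w i - 1 else w i) := by
  have key : ∀ e' ∈ H, e' ≠ e →
      edgeW f (fun i => if i ∈ e then w i - 1 else w i) e <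
        edgeW f (fun i => if i ∈ e then w i - 1 else w i) e' := by
    intro e' he' hne
    have hpos : ∀ i, 0 < f (w i) - f (w i - 1) := fun i => by
      have := hw i
      exact sub_pos.mpr (hf.1 ⟨by omega, by omega⟩ ⟨by omega, by omega⟩ (by omega))
    have hsub : ¬ e ⊆ e' := fun h => hH e he e' he' (h.ssubset_of_ne hne.symm)
    obtain ⟨x, hxe, hxe'⟩ := Finset.not_subset.mp hsub
    have hlt : ∑ i ∈ e' ∩ e, (f (w i) - f (w i - 1)) < ∑ i ∈ e, (f (w i) - f (w i - 1)) :=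
      Finset.sum_lt_sum_of_subset Finset.inter_subset_right hxe
        (fun h => hxe' (Finset.mem_inter.mp h).1) (hpos x) fun i _ _ => (hpos i).le
    rw [edgeW_sub_indicator, edgeW_sub_indicator, Finset.inter_self]
    linarith [hmin e' he']
  refine ⟨key, Or.inr ⟨e, ⟨he, key⟩, fun e' h => ?_⟩⟩
  by_contra hne
  exact lt_asymm (key e' h.1 hne) (h.2 e he (Ne.symm hne))
end

section
/- Let H be an inclusion-free hypergraph on vertex set [n] and let f: [M] → ℝ be a strictly increasing function with strictly positive values. Then the number of isolating weights satisfies |Z(H,M,f)| ≥ (M−1)^n. -/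
open Finset

/-- The weight obtained from `w` by decreasing the weight of every vertex of `e` by one. -/
def lowerOn {V : Type*} [DecidableEq V] (w : V → ℕ) (e : Finset V) (i : V) : ℕ :=
  if i ∈ e then w i - 1 else w i

theorem edgeW_lowerOn {V : Type*} [DecidableEq V] (f : ℕ → ℝ) (w : V → ℕ) (e s : Finset V) :
    edgeW f (lowerOn w e) s = edgeW f w s - ∑ i ∈ s ∩ e, (f (w i) - f (w i - 1)) := by
  unfold edgeW lowerOn
  rw [← Finset.sum_ite_mem, ← Finset.sum_sub_distrib]
  refine Finset.sum_congr rfl fun i _ => ?_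
  split_ifs <;> ring

/-- Lowering the weights on an edge of minimum weight makes it the unique edge of minimum
weight. -/
theorem edgeW_lowerOn_lt {V : Type*} [DecidableEq V] {M : ℕ} {H : Finset (Finset V)}
    {f : ℕ → ℝ} {w : V → ℕ} {e e' : Finset V} (hH : InclFree H)
    (hf : StrictMonoOn f (Set.Icc 1 M)) (hw : ∀ i, 2 ≤ w i ∧ w i ≤ M) (he : e ∈ H)
    (hmin : ∀ s ∈ H, edgeW f w e ≤ edgeW f w s) (he' : e' ∈ H) (hne : e' ≠ e) :
    edgeW f (lowerOn w e) e < edgeW f (lowerOn w e) e' := by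
  have hpos : ∀ i, 0 < f (w i) - f (w i - 1) := fun i => by
    obtain ⟨h2, hM⟩ := hw i
    exact sub_pos.2 (hf ⟨by omega, by omega⟩ ⟨by omega, hM⟩ (by omega))
  have hnot : ¬ e ⊆ e' := fun h => hH e he e' he' (h.ssubset_of_ne hne.symm)
  obtain ⟨i, hi, hi'⟩ := Finset.not_subset.1 hnot
  have hlt : ∑ i ∈ e' ∩ e, (f (w i) - f (w i - 1)) < ∑ i ∈ e, (f (w i) - f (w i - 1)) :=
    Finset.sum_lt_sum_of_subset Finset.inter_subset_right hi (by simp [hi']) (hpos i)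
      fun j _ _ => (hpos j).le
  rw [edgeW_lowerOn, edgeW_lowerOn, Finset.inter_self]
  linarith [hmin e' he']

theorem Zset_finite {V : Type*} [Finite V] (M : ℕ) (H : Finset (Finset V)) (f : ℕ → ℝ) :
    (Zset M H f).Finite :=
  (Set.Finite.pi' fun _ => Set.finite_Icc 1 M).subset fun _ hw => hw.1

/-- Ta-Shma's bound.  For every inclusion-free hypergraph `H` on
`[n]` and every objective function `f : [M] → ℝ`, the number of isolating weights
satisfies `|Z(H,M,f)| ≥ (M-1)^n`. -/
theorem stmt_1 {n M : ℕ} (H : Finset (Finset (Fin n))) (f : ℕ → ℝ)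
    (hH : InclFree H) (hf : Objective M f) :
    (M - 1) ^ n ≤ (Zset M H f).ncard := by
  classical
  have hcard : (Fintype.piFinset fun _ : Fin n => Finset.Icc 2 M).card = (M - 1) ^ n := by
    simp
  rw [← hcard, ← Set.ncard_coe_finset]
  have hmem : ∀ w : Fin n → ℕ,
      w ∈ (↑(Fintype.piFinset fun _ : Fin n => Finset.Icc 2 M) : Set (Fin n → ℕ)) →
        ∀ i, 2 ≤ w i ∧ w i ≤ M := fun w hw i => by
    simpa using Fintype.mem_piFinset.1 (Finset.mem_coe.1 hw) i
  obtain rfl | hne := H.eq_empty_or_nonempty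
  · refine Set.ncard_le_ncard (fun w hw => ⟨fun i => ?_, Or.inl rfl⟩) (Zset_finite M _ f)
    have := hmem w hw i
    omega
  choose e he hmin using fun w : Fin n → ℕ => H.exists_min_image (edgeW f w) hne
  have hlt : ∀ w : Fin n → ℕ, (∀ i, 2 ≤ w i ∧ w i ≤ M) → ∀ e' ∈ H, e' ≠ e w →
      edgeW f (lowerOn w (e w)) (e w) < edgeW f (lowerOn w (e w)) e' :=
    fun w hw e' => edgeW_lowerOn_lt hH hf.1 hw (he w) (hmin w)
  refine Set.ncard_le_ncard_of_injOn (fun w => lowerOn w (e w)) ?_ ?_ (Zset_finite M H f)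
  · intro w hw
    have hw := hmem w hw
    refine ⟨fun i => ?_, Or.inr ⟨e w, ⟨he w, hlt w hw⟩, ?_⟩⟩
    · have := hw i
      dsimp only [lowerOn]
      split_ifs <;> omega
    · rintro s ⟨hs, hs'⟩
      by_contra hse
      exact lt_asymm (hlt w hw s hs hse) (hs' (e w) (he w) (Ne.symm hse))
  · intro w hw v hv hwv
    have hw := hmem w hw
    have hv := hmem v hv
    dsimp only at hwv
    have hev : e w = e v := by
      by_contra hne'
      have h1 := hlt w hw (e v) (he v) (Ne.symm hne')
      have h2 := hlt v hv (e w) (he w) hne'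
      rw [hwv] at h1
      exact lt_asymm h1 h2
    funext i
    have h := congrFun hwv i
    have := hw i
    have := hv i
    rw [hev] at h
    dsimp only [lowerOn] at h
    split_ifs at h <;> omega
end

section
/- Let H be an inclusion-free hypergraph on vertex set [n], let f: [M] → ℝ be a strictly increasing function with strictly positive values, and let w: [n] → [M]. Suppose e ∈ H is a min-weight edge for w, there is some vertex ℓ ∈ [n] contained in every min-weight edge, and w(i) ≥ 2 for all i ≠ ℓ. Then the weight w − χ_{e∖{ℓ}} is isolating for H and f, and e is its unique min-weight edge. -/
open Finset

/-- Proposition 3 of the paper.  If `e ∈ H` is a min-weight edge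
for `w`, every min-weight edge contains `ℓ`, and `w(i) ≥ 2` for all `i ≠ ℓ`, then
`w - χ_{e∖{ℓ}}` is isolating for `H, f` with unique min-weight edge `e`. -/
theorem stmt_2 {n M : ℕ} (H : Finset (Finset (Fin n))) (f : ℕ → ℝ)
    (hH : InclFree H) (hf : Objective M f)
    (w : Fin n → ℕ) (hw : ∀ i, 1 ≤ w i ∧ w i ≤ M)
    (e : Finset (Fin n)) (he : e ∈ H)
    (hmin : ∀ e' ∈ H, edgeW f w e ≤ edgeW f w e')
    (ℓ : Fin n)
    (hℓ : ∀ e' ∈ H, (∀ e'' ∈ H, edgeW f w e' ≤ edgeW f w e'') → ℓ ∈ e')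
    (hw2 : ∀ i, i ≠ ℓ → 2 ≤ w i) :
    (∀ e' ∈ H, e' ≠ e →
        edgeW f (fun i => if i ∈ e.erase ℓ then w i - 1 else w i) e <
          edgeW f (fun i => if i ∈ e.erase ℓ then w i - 1 else w i) e') ∧
      Isolating H f (fun i => if i ∈ e.erase ℓ then w i - 1 else w i) := by
  set v : Fin n → ℕ := fun i => if i ∈ e.erase ℓ then w i - 1 else w i
  have hpos : ∀ i ∈ e.erase ℓ, 0 < f (w i) - f (v i) := by
    intro i hi
    have h2 := hw2 i (ne_of_mem_erase hi)
    have hM := (hw i).2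
    have hvi : v i = w i - 1 := if_pos hi
    rw [hvi]
    exact sub_pos.2 (hf.1 ⟨by omega, by omega⟩ ⟨by omega, hM⟩ (by omega))
  have hzero : ∀ i ∉ e.erase ℓ, f (w i) - f (v i) = 0 := by
    intro i hi
    have hvi : v i = w i := if_neg hi
    rw [hvi, sub_self]
  have hdecr : ∀ s : Finset (Fin n),
      edgeW f w s - edgeW f v s = ∑ i ∈ s ∩ e.erase ℓ, (f (w i) - f (v i)) := by
    intro s
    rw [edgeW, edgeW, ← sum_sub_distrib]
    refine (sum_subset inter_subset_left fun i hi hi' => hzero i fun h => ?_).symm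
    exact hi' (mem_inter.2 ⟨hi, h⟩)
  have hdecr_e := hdecr e
  rw [inter_eq_right.2 (erase_subset ℓ e)] at hdecr_e
  have hlt : ∀ e' ∈ H, e' ≠ e → edgeW f v e < edgeW f v e' := by
    intro e' he' hne
    have hdecr_e' := hdecr e'
    rcases (hmin e' he').lt_or_eq with h | h
    · have hle : ∑ i ∈ e' ∩ e.erase ℓ, (f (w i) - f (v i)) ≤
          ∑ i ∈ e.erase ℓ, (f (w i) - f (v i)) :=
        sum_le_sum_of_subset_of_nonneg inter_subset_right fun i hi _ => (hpos i hi).le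
      linarith
    · have hℓe' : ℓ ∈ e' := hℓ e' he' (h ▸ hmin)
      have hsub : ¬ e ⊆ e' := fun hs => hH e he e' he' (hs.ssubset_of_ne hne.symm)
      obtain ⟨i, hie, hie'⟩ := not_subset.1 hsub
      have hi : i ∈ e.erase ℓ := mem_erase.2 ⟨fun hiℓ => hie' (hiℓ ▸ hℓe'), hie⟩
      have hlt : ∑ i ∈ e' ∩ e.erase ℓ, (f (w i) - f (v i)) <
          ∑ i ∈ e.erase ℓ, (f (w i) - f (v i)) :=
        sum_lt_sum_of_subset inter_subset_right hi (fun h => hie' (mem_inter.1 h).1)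
          (hpos i hi) fun j hj _ => (hpos j hj).le
      linarith
  refine ⟨hlt, Or.inr ⟨e, ⟨he, hlt⟩, fun e' ⟨he', hlt'⟩ => ?_⟩⟩
  by_contra hne
  exact lt_asymm (hlt e' he' hne) (hlt' e he (Ne.symm hne))
end

section
/- For every inclusion-free hypergraph H on [n] and every strictly increasing function f: [M] → ℝ with strictly positive values, the total number of isolating weights satisfies |Z(H,M,f)| ≥ ∑_{j=1}^{M} Y_1(j,n), where Y_1(j,n) is the infimum over all inclusion-free hypergraphs H' on [n] and all strictly increasing positive functions g: [j] → ℝ of the number of isolating weights in [j]^n whose minimum entry equals 1. -/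
open Finset

/-- `Y_1(M,n)`: the infimum, over inclusion-free hypergraphs `H` on `[n]` and
objective functions `f : [M] → ℝ`, of the number of isolating weights of layer `1`. -/
noncomputable def Y1 (M n : ℕ) : ℕ :=
  sInf {k | ∃ (H : Finset (Finset (Fin n))) (f : ℕ → ℝ),
    InclFree H ∧ Objective M f ∧ k = (Zlayer M 1 H f).ncard}

theorem Y1_le_ncard_Zlayer {n M : ℕ} {H : Finset (Finset (Fin n))} {f : ℕ → ℝ}
    (hH : InclFree H) (hf : Objective M f) : Y1 M n ≤ (Zlayer M 1 H f).ncard :=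
  Nat.sInf_le ⟨H, f, hH, hf, rfl⟩

theorem Objective.shift {M : ℕ} {f : ℕ → ℝ} (hf : Objective (M + 1) f) :
    Objective M fun k => f (k + 1) := by
  have hmem : ∀ k ∈ Set.Icc 1 M, k + 1 ∈ Set.Icc 1 (M + 1) := by
    intro k hk
    simp only [Set.mem_Icc] at hk ⊢
    omega
  exact ⟨fun a ha b hb hab => hf.1 (hmem a ha) (hmem b hb) (by omega),
    fun k hk => hf.2 _ (hmem k hk)⟩

/-- Raising every vertex weight by one turns isolating weights for the shifted objective
function into isolating weights for the original one. -/
theorem image_succ_Zset_subset {V : Type*} (M : ℕ) (H : Finset (Finset V)) (f : ℕ → ℝ) :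
    (fun (w : V → ℕ) i => w i + 1) '' Zset M H (fun k => f (k + 1)) ⊆ Zset (M + 1) H f := by
  rintro _ ⟨w, ⟨hw, hiso⟩, rfl⟩
  exact ⟨fun i => ⟨by simp, Nat.succ_le_succ (hw i).2⟩, hiso⟩

theorem ncard_Zset_add_ncard_Zlayer_le {V : Type*} [Finite V] (M : ℕ)
    (H : Finset (Finset V)) (f : ℕ → ℝ) :
    (Zset M H fun k => f (k + 1)).ncard + (Zlayer (M + 1) 1 H f).ncard
      ≤ (Zset (M + 1) H f).ncard := by
  have hinj : Function.Injective fun (w : V → ℕ) i => w i + 1 := fun w w' h =>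
    funext fun i => Nat.succ_injective (congrFun h i)
  have hsub : Zlayer (M + 1) 1 H f ⊆ Zset (M + 1) H f := fun w hw => hw.1
  have hdisj : Disjoint ((fun (w : V → ℕ) i => w i + 1) '' Zset M H fun k => f (k + 1))
      (Zlayer (M + 1) 1 H f) := by
    rw [Set.disjoint_left]
    rintro _ ⟨w, ⟨hw, -⟩, rfl⟩ ⟨-, -, i, hi⟩
    have := (hw i).1
    simp only at hi
    omega
  rw [← Set.ncard_image_of_injective _ hinj,
    ← Set.ncard_union_eq hdisj ((Zset_finite _ _ _).image _) ((Zset_finite _ _ _).subset hsub)]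
  exact Set.ncard_le_ncard (Set.union_subset (image_succ_Zset_subset M H f) hsub)
    (Zset_finite _ _ _)

/-- Corollary 7 of the paper.  For every inclusion-free hypergraph
`H` on `[n]` and objective function `f : [M] → ℝ`,
`|Z(H,M,f)| ≥ ∑_{j=1}^{M} Y_1(j,n)`. -/
theorem stmt_5 {n M : ℕ} (H : Finset (Finset (Fin n))) (f : ℕ → ℝ)
    (hH : InclFree H) (hf : Objective M f) :
    ∑ j ∈ Finset.Icc 1 M, Y1 j n ≤ (Zset M H f).ncard := by
  induction M generalizing f with
  | zero => simp
  | succ M ih =>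
    rw [Finset.sum_Icc_succ_top (by omega)]
    exact (add_le_add (ih _ hf.shift) (Y1_le_ncard_Zlayer hH hf)).trans
      (ncard_Zset_add_ncard_Zlayer_le M H f)
end

section
/- Let M ≥ 2, let H be an inclusion-free hypergraph on [n], and let f: [M] → ℝ be strictly increasing with strictly positive values. Then the number of isolating weights with minimum entry 1 satisfies |Z_1(H,M,f)| ≥ 2(M−1)^n − 2(M−2)^n − n(M−2)^{n−1}. -/
open Finset

section

variable {V : Type*}

/-- The edge `e` is the unique edge of minimum weight. -/
def Isolates (H : Finset (Finset V)) (f : ℕ → ℝ) (w : V → ℕ) (e : Finset V) : Prop :=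
  e ∈ H ∧ ∀ e' ∈ H, e' ≠ e → edgeW f w e < edgeW f w e'

theorem Isolates.eq {H : Finset (Finset V)} {f : ℕ → ℝ} {w : V → ℕ} {e e' : Finset V}
    (h : Isolates H f w e) (h' : Isolates H f w e') : e = e' := by
  by_contra hne
  exact lt_asymm (h.2 e' h'.1 (Ne.symm hne)) (h'.2 e h.1 hne)

theorem isolates_of_unique_min {H : Finset (Finset V)} {f : ℕ → ℝ} {w : V → ℕ} {e : Finset V}
    (he : e ∈ H) (hmin : ∀ e' ∈ H, edgeW f w e ≤ edgeW f w e')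
    (huniq : ∀ e' ∈ H, (∀ e'' ∈ H, edgeW f w e' ≤ edgeW f w e'') → e' = e) :
    Isolates H f w e := by
  refine ⟨he, fun e' he' hne => lt_of_le_of_ne (hmin e' he') fun h => hne ?_⟩
  exact huniq e' he' fun e'' he'' => h ▸ hmin e'' he''

/-- The vertices of weight `2`. -/
def twos [Fintype V] (v : V → ℕ) : Finset V := univ.filter fun i => v i = 2

theorem mem_twos [Fintype V] {v : V → ℕ} {i : V} : i ∈ twos v ↔ v i = 2 := by simp [twos]

variable [DecidableEq V]

/-- Decrease the weights on `S` by one. -/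
def lower (S : Finset V) (v : V → ℕ) : V → ℕ := fun i => if i ∈ S then v i - 1 else v i

/-- Increase by one the weights on the edge `x.1` and all weights equal to `1`. -/
def raise (x : Finset V × (V → ℕ)) : V → ℕ :=
  fun i => if i ∈ x.1 ∨ x.2 i = 1 then x.2 i + 1 else x.2 i

theorem isolates_lower {M : ℕ} {H : Finset (Finset V)} {f : ℕ → ℝ} (hH : InclFree H)
    (hf : Objective M f) {v : V → ℕ} (hv : ∀ i, 2 ≤ v i ∧ v i ≤ M) {p : V} (hp : v p = 2)
    {e : Finset V} (he : e ∈ H)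
    (hmin : ∀ e' ∈ H, edgeW f (lower {p} v) e ≤ edgeW f (lower {p} v) e') :
    Isolates H f (lower (insert p e) v) e := by
  refine ⟨he, fun e' he' hne => ?_⟩
  obtain ⟨s, hs, hs'⟩ : ∃ s ∈ e, s ∉ e' := by
    by_contra! h
    exact hH e he e' he' (Finset.ssubset_iff_subset_ne.2 ⟨h, hne.symm⟩)
  obtain ⟨t, ht, ht'⟩ : ∃ t ∈ e', t ∉ e := by
    by_contra! h
    exact hH e' he' e he (Finset.ssubset_iff_subset_ne.2 ⟨h, hne⟩)
  have hm := hmin e' he'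
  unfold edgeW at hm ⊢
  rw [← Finset.sum_sdiff_le_sum_sdiff] at hm
  rw [← Finset.sum_sdiff_lt_sum_sdiff]
  have hoff : ∑ i ∈ e' \ e, f (lower {p} v i) = ∑ i ∈ e' \ e, f (lower (insert p e) v i) := by
    refine Finset.sum_congr rfl fun i hi => ?_
    have := (Finset.mem_sdiff.1 hi).2
    simp [lower, this]
  have hon : ∀ i ∈ e \ e', f (lower (insert p e) v i) ≤ f (lower {p} v i) := by
    intro i hi
    have hie := (Finset.mem_sdiff.1 hi).1
    have hvi := hv i
    refine hf.1.monotoneOn ?_ ?_ ?_ <;> simp only [lower, Finset.mem_insert, Finset.mem_singleton,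
      hie, or_true, if_true, Set.mem_Icc] <;> first | omega | (split_ifs <;> omega)
  by_cases hsp : ∃ s ∈ e \ e', s ≠ p
  · obtain ⟨s, hs, hsp⟩ := hsp
    refine lt_of_lt_of_le (Finset.sum_lt_sum hon ⟨s, hs, ?_⟩) (hm.trans_eq hoff)
    have hse := (Finset.mem_sdiff.1 hs).1
    have hvi := hv s
    refine hf.1 ?_ ?_ ?_ <;> simp only [lower, Finset.mem_insert, Finset.mem_singleton,
      hse, hsp, or_true, if_true, if_false, Set.mem_Icc] <;> omega
  · push Not at hsp
    have hsub : e \ e' = {p} := by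
      ext i
      simp only [Finset.mem_singleton]
      refine ⟨hsp i, ?_⟩
      rintro rfl
      have := hsp s (Finset.mem_sdiff.2 ⟨hs, hs'⟩)
      subst this
      exact Finset.mem_sdiff.2 ⟨hs, hs'⟩
    have hpe : p ∈ e := (Finset.mem_sdiff.1 (hsub ▸ Finset.mem_singleton_self p)).1
    have htp : t ≠ p := by rintro rfl; exact ht' hpe
    rw [hsub, Finset.sum_singleton]
    have hvt := hv t
    have hlt : f (lower (insert p e) v p) < f (lower (insert p e) v t) := by
      refine hf.1 ?_ ?_ ?_ <;> simp [lower, hp, htp, ht'] <;> omega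
    refine hlt.trans_le (Finset.single_le_sum (f := fun i => f (lower (insert p e) v i)) ?_
      (Finset.mem_sdiff.2 ⟨ht, ht'⟩))
    intro i _
    have hvi := hv i
    refine (hf.2 _ ?_).le
    simp only [lower, Set.mem_Icc]
    split_ifs <;> omega

theorem raise_lower {v : V → ℕ} (hv : ∀ i, 2 ≤ v i) {p : V} (hp : v p = 2) (e : Finset V) :
    raise (e, lower (insert p e) v) = v := by
  funext i
  have := hv i
  simp only [raise, lower, Finset.mem_insert]
  by_cases hi : i ∈ e
  · simp [hi]; omega
  · by_cases hip : i = p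
    · simp [hip, hp]
    · simp [hi, hip]; omega

theorem eq_of_lower_eq {S T : Finset V} {v : V → ℕ} (hv : ∀ i, 2 ≤ v i)
    (h : lower S v = lower T v) : S = T := by
  ext i
  have h' := congrFun h i
  have := hv i
  simp only [lower] at h'
  split_ifs at h' <;> first | (simp [*]; done) | omega

variable [Fintype V]

/-- Weights with minimum exactly `2`. -/
def minTwo (V : Type*) [Fintype V] [DecidableEq V] (M : ℕ) : Finset (V → ℕ) :=
  (Fintype.piFinset fun _ => Icc 2 M).filter fun v => (twos v).Nonempty

open Classical in
/-- Pairs of an edge and a weight of minimum `1` isolating it. -/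
noncomputable def isoPairs (M : ℕ) (H : Finset (Finset V)) (f : ℕ → ℝ) :
    Finset (Finset V × (V → ℕ)) :=
  (H ×ˢ Fintype.piFinset fun _ => Icc 1 M).filter fun x =>
    Isolates H f x.2 x.1 ∧ ∃ i, x.2 i = 1

theorem mem_minTwo {M : ℕ} {v : V → ℕ} :
    v ∈ minTwo V M ↔ (∀ i, 2 ≤ v i ∧ v i ≤ M) ∧ (twos v).Nonempty := by
  simp [minTwo]

theorem mem_isoPairs {M : ℕ} {H : Finset (Finset V)} {f : ℕ → ℝ} {x : Finset V × (V → ℕ)} :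
    x ∈ isoPairs M H f ↔
      (∀ i, 1 ≤ x.2 i ∧ x.2 i ≤ M) ∧ Isolates H f x.2 x.1 ∧ ∃ i, x.2 i = 1 := by
  simp only [isoPairs, Finset.mem_filter, Finset.mem_product, Fintype.mem_piFinset, Finset.mem_Icc]
  exact ⟨fun h => ⟨h.1.2, h.2⟩, fun h => ⟨⟨h.2.1.1, h.1⟩, h.2⟩⟩

open Classical in
/-- Triples `(e, v, p)` such that all vertices of weight `2` lie in `e`, `p` is one of them, and
lowering `p` alone isolates `e`. -/
noncomputable def pointTriples (M : ℕ) (H : Finset (Finset V)) (f : ℕ → ℝ) :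
    Finset (Finset V × (V → ℕ) × V) :=
  (H ×ˢ minTwo V M ×ˢ univ).filter fun x =>
    twos x.2.1 ⊆ x.1 ∧ x.2.2 ∈ twos x.2.1 ∧ Isolates H f (lower {x.2.2} x.2.1) x.1

theorem mem_pointTriples {M : ℕ} {H : Finset (Finset V)} {f : ℕ → ℝ}
    {x : Finset V × (V → ℕ) × V} :
    x ∈ pointTriples M H f ↔ x.2.1 ∈ minTwo V M ∧ twos x.2.1 ⊆ x.1 ∧ x.2.2 ∈ twos x.2.1 ∧
      Isolates H f (lower {x.2.2} x.2.1) x.1 := by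
  simp only [pointTriples, Finset.mem_filter, Finset.mem_product, Finset.mem_univ, and_true]
  exact ⟨fun h => ⟨h.1.2, h.2⟩, fun h => ⟨⟨h.2.2.2.1, h.1⟩, h.2⟩⟩

/-- Isolating pairs lying over a weight with a single vertex of weight `2`, this vertex being
in the edge. -/
noncomputable def singlePairs (M : ℕ) (H : Finset (Finset V)) (f : ℕ → ℝ) :
    Finset (Finset V × (V → ℕ)) :=
  (isoPairs M H f).filter fun x =>
    raise x ∈ minTwo V M ∧ (twos (raise x)).card = 1 ∧ twos (raise x) ⊆ x.1

theorem mem_fiber {M : ℕ} {H : Finset (Finset V)} {f : ℕ → ℝ} (hH : InclFree H)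
    (hf : Objective M f) {v : V → ℕ} (hv : ∀ i, 2 ≤ v i ∧ v i ≤ M) {p : V} (hp : v p = 2)
    {e : Finset V} (he : e ∈ H)
    (hmin : ∀ e' ∈ H, edgeW f (lower {p} v) e ≤ edgeW f (lower {p} v) e') :
    (e, lower (insert p e) v) ∈ (isoPairs M H f).filter fun x => raise x = v := by
  rw [Finset.mem_filter, mem_isoPairs]
  refine ⟨⟨fun i => ?_, isolates_lower hH hf hv hp he hmin, p, by simp [lower, hp]⟩,
    raise_lower (fun i => (hv i).1) hp e⟩
  have := hv i
  simp only [lower]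
  split_ifs <;> omega

theorem local_bound {M : ℕ} {H : Finset (Finset V)} {f : ℕ → ℝ} (hH : InclFree H)
    (hne : H.Nonempty) (hf : Objective M f) {v : V → ℕ} (hv : v ∈ minTwo V M) :
    2 * (if (twos v).card = 1 then 1 else 2) +
        ((singlePairs M H f).filter fun x => raise x = v).card ≤
      2 * ((isoPairs M H f).filter fun x => raise x = v).card +
        ((pointTriples M H f).filter fun x => x.2.1 = v).card := by
  obtain ⟨hv2, p, hp⟩ := mem_minTwo.1 hv
  set F := (isoPairs M H f).filter fun x => raise x = v
  have hmem : ∀ p ∈ twos v, ∀ e ∈ H,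
      (∀ e' ∈ H, edgeW f (lower {p} v) e ≤ edgeW f (lower {p} v) e') →
      (e, lower (insert p e) v) ∈ F :=
    fun p hp e he hmin => mem_fiber hH hf hv2 (mem_twos.1 hp) he hmin
  have hsub : ((singlePairs M H f).filter fun x => raise x = v) ⊆ F :=
    Finset.filter_subset_filter _ (Finset.filter_subset _ _)
  have hle := Finset.card_le_card hsub
  obtain ⟨e, he, hmin⟩ := H.exists_min_image (edgeW f (lower {p} v)) hne
  have hpos : 0 < F.card := Finset.card_pos.2 ⟨_, hmem p hp e he hmin⟩
  by_cases hF2 : 2 ≤ F.card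
  · by_cases h1 : (twos v).card = 1
    · simp only [h1, if_true]; omega
    · have h0 : ((singlePairs M H f).filter fun x => raise x = v) = ∅ := by
        refine Finset.filter_eq_empty_iff.2 fun x hx hxv => h1 ?_
        exact hxv ▸ (Finset.mem_filter.1 hx).2.2.1
      simp only [h1, if_false, h0, Finset.card_empty]; omega
  have hone : F.card = 1 := by omega
  have hall : ∀ x ∈ F, x = (e, lower (insert p e) v) := fun x hx =>
    Finset.card_le_one.1 hone.le x hx _ (hmem p hp e he hmin)
  have hkey : ∀ q ∈ twos v, insert q e = insert p e ∧ Isolates H f (lower {q} v) e := by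
    intro q hq
    obtain ⟨e₁, he₁, hmin₁⟩ := H.exists_min_image (edgeW f (lower {q} v)) hne
    have h₁ := hall _ (hmem q hq e₁ he₁ hmin₁)
    obtain ⟨rfl, h₂⟩ := Prod.mk.inj h₁
    refine ⟨eq_of_lower_eq (fun i => (hv2 i).1) h₂,
      isolates_of_unique_min he₁ hmin₁ fun e' he' hmin' => ?_⟩
    exact congrArg Prod.fst (hall _ (hmem q hq e' he' hmin'))
  have htriple : twos v ⊆ e →
      (twos v).card ≤ ((pointTriples M H f).filter fun x => x.2.1 = v).card := by
    intro hse
    refine Finset.card_le_card_of_injOn (fun q => (e, v, q)) (fun q hq => ?_)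
      (fun a _ b _ h => by simpa using h)
    simp only [Finset.coe_filter, Set.mem_ofPred_eq, and_true, mem_pointTriples]
    exact ⟨hv, hse, hq, (hkey q hq).2⟩
  by_cases h1 : (twos v).card = 1
  · simp only [h1, if_true, hone]
    rcases Finset.eq_empty_or_nonempty ((singlePairs M H f).filter fun x => raise x = v) with
      h0 | ⟨x, hx⟩
    · rw [h0, Finset.card_empty]; omega
    · have hxe := hall x (hsub hx)
      rw [Finset.mem_filter] at hx
      have hse : twos v ⊆ e := by
        have := (Finset.mem_filter.1 hx.1).2.2.2
        rwa [hx.2, hxe] at this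
      have := htriple hse
      omega
  · have hgt : 1 < (twos v).card := by
      have := Finset.card_pos.2 ⟨p, hp⟩
      omega
    have hse : twos v ⊆ e := by
      intro q hq
      obtain ⟨r, hr, hrq⟩ := Finset.exists_mem_ne hgt q
      have h₁ : q ∈ insert r e := by
        rw [(hkey r hr).1, ← (hkey q hq).1]
        exact Finset.mem_insert_self _ _
      exact Finset.mem_of_mem_insert_of_ne h₁ hrq.symm
    have h0 : ((singlePairs M H f).filter fun x => raise x = v) = ∅ := by
      refine Finset.filter_eq_empty_iff.2 fun x hx hxv => h1 ?_
      exact hxv ▸ (Finset.mem_filter.1 hx).2.2.1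
    have := htriple hse
    simp only [h1, if_false, h0, Finset.card_empty, hone]
    omega

theorem card_pointTriples_le (M : ℕ) (H : Finset (Finset V)) (f : ℕ → ℝ) :
    (pointTriples M H f).card ≤ (singlePairs M H f).card +
      ((isoPairs M H f).filter fun x => raise x ∉ minTwo V M).card := by
  refine le_trans (Finset.card_le_card_of_injOn
    (t := singlePairs M H f ∪ (isoPairs M H f).filter fun x => raise x ∉ minTwo V M)
    (fun x => (x.1, lower {x.2.2} x.2.1)) ?_ ?_) (Finset.card_union_le _ _)
  · rintro ⟨e, v, p⟩ hx
    obtain ⟨hv, hse, hp, hiso⟩ := mem_pointTriples.1 (Finset.mem_coe.1 hx)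
    simp only at hv hse hp hiso
    have hv2 := (mem_minTwo.1 hv).1
    have hp2 := mem_twos.1 hp
    have hpair : (e, lower {p} v) ∈ isoPairs M H f := by
      refine mem_isoPairs.2 ⟨fun i => ?_, hiso, p, by simp [lower, hp2]⟩
      have := hv2 i
      simp only [lower]
      split_ifs <;> omega
    have htwos : twos (raise (e, lower {p} v)) = {p} := by
      ext i
      have hvi := hv2 i
      have hie : v i = 2 → i ∈ e := fun h => hse (mem_twos.2 h)
      rw [mem_twos, Finset.mem_singleton]
      simp only [raise, lower, Finset.mem_singleton]
      by_cases hip : i = p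
      · simp [hip, hp2]
      · by_cases hi : i ∈ e
        · simp [hip, hi]; omega
        · have : v i ≠ 2 := fun h => hi (hie h)
          simp only [hip, hi, if_false, false_or, iff_false]
          split_ifs <;> omega
    by_cases hr : raise (e, lower {p} v) ∈ minTwo V M
    · refine Finset.mem_coe.2 (Finset.mem_union_left _ (Finset.mem_filter.2 ⟨hpair, hr, ?_, ?_⟩))
      · rw [htwos, Finset.card_singleton]
      · rw [htwos, Finset.singleton_subset_iff]
        exact hse hp
    · exact Finset.mem_coe.2 (Finset.mem_union_right _ (Finset.mem_filter.2 ⟨hpair, hr⟩))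
  · rintro ⟨e, v, p⟩ hx ⟨e', v', p'⟩ hx' h
    obtain ⟨hv, -, hp, -⟩ := mem_pointTriples.1 (Finset.mem_coe.1 hx)
    obtain ⟨hv', -, hp', -⟩ := mem_pointTriples.1 (Finset.mem_coe.1 hx')
    simp only at hv hp hv' hp'
    obtain ⟨rfl, h⟩ := Prod.mk.inj h
    have hv2 := (mem_minTwo.1 hv).1
    have hv2' := (mem_minTwo.1 hv').1
    rw [mem_twos] at hp hp'
    have h : ∀ i, (if i = p then v i - 1 else v i) = if i = p' then v' i - 1 else v' i :=
      fun i => by simpa [lower] using congrFun h i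
    have hpp : p = p' := by
      by_contra hne
      have := h p
      simp only [if_true, hne, if_false] at this
      have := hv2' p
      omega
    subst hpp
    have hvv : v = v' := by
      funext i
      have := h i
      by_cases hi : i = p
      · rw [hi, hp, hp']
      · simpa [hi] using this
    rw [hvv]

theorem sum_le_card_isoPairs {M : ℕ} {H : Finset (Finset V)} {f : ℕ → ℝ} (hH : InclFree H)
    (hne : H.Nonempty) (hf : Objective M f) :
    ∑ v ∈ minTwo V M, (if (twos v).card = 1 then 1 else 2) ≤ (isoPairs M H f).card := by
  have hloc := Finset.sum_le_sum fun v hv => local_bound hH hne hf (v := v) (M := M) hv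
  simp only [Finset.sum_add_distrib, ← Finset.mul_sum] at hloc
  have hS : (singlePairs M H f).card =
      ∑ v ∈ minTwo V M, ((singlePairs M H f).filter fun x => raise x = v).card :=
    Finset.card_eq_sum_card_fiberwise fun x hx => (Finset.mem_filter.1 hx).2.1
  have hP : (pointTriples M H f).card =
      ∑ v ∈ minTwo V M, ((pointTriples M H f).filter fun x => x.2.1 = v).card :=
    Finset.card_eq_sum_card_fiberwise fun x hx => (mem_pointTriples.1 (Finset.mem_coe.1 hx)).1
  have hI : ((isoPairs M H f).filter fun x => raise x ∈ minTwo V M).card =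
      ∑ v ∈ minTwo V M, ((isoPairs M H f).filter fun x => raise x = v).card := by
    have hmaps : ∀ x ∈ (isoPairs M H f).filter (fun x => raise x ∈ minTwo V M),
        raise x ∈ minTwo V M := fun x hx => (Finset.mem_filter.1 hx).2
    rw [Finset.card_eq_sum_card_fiberwise hmaps]
    refine Finset.sum_congr rfl fun v hv => ?_
    rw [Finset.filter_filter]
    congr 1
    refine Finset.filter_congr fun x _ => ?_
    exact ⟨fun h => h.2, fun h => ⟨h ▸ hv, h⟩⟩
  have hsplit := Finset.card_filter_add_card_filter_not (s := isoPairs M H f)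
    (fun x => raise x ∈ minTwo V M)
  have hle := card_pointTriples_le M H f
  rw [← hS, ← hP, ← hI] at hloc
  omega

theorem card_isoPairs_le (M : ℕ) (H : Finset (Finset V)) (f : ℕ → ℝ) :
    (isoPairs M H f).card ≤ (Zlayer M 1 H f).ncard := by
  have hfin : (Zlayer M 1 H f : Set (V → ℕ)).Finite := by
    refine (Fintype.piFinset fun _ : V => Icc 1 M).finite_toSet.subset fun w hw => ?_
    exact Finset.mem_coe.2 (Fintype.mem_piFinset.2 fun i => Finset.mem_Icc.2 (hw.1.1 i))
  rw [Set.ncard_eq_toFinset_card _ hfin]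
  refine Finset.card_le_card_of_injOn Prod.snd (fun x hx => ?_) ?_
  · obtain ⟨hb, hiso, h1⟩ := mem_isoPairs.1 (Finset.mem_coe.1 hx)
    rw [Set.Finite.coe_toFinset]
    exact ⟨⟨hb, Or.inr ⟨x.1, hiso, fun e he => Isolates.eq he hiso⟩⟩, fun i => (hb i).1, h1⟩
  · intro x hx y hy h
    have hx' := (mem_isoPairs.1 (Finset.mem_coe.1 hx)).2.1
    have hy' := (mem_isoPairs.1 (Finset.mem_coe.1 hy)).2.1
    rw [← h] at hy'
    exact Prod.ext (hx'.eq hy') h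

theorem card_minTwo (M : ℕ) :
    (minTwo V M).card + (M - 2) ^ Fintype.card V = (M - 1) ^ Fintype.card V := by
  have hcompl : ((Fintype.piFinset fun _ : V => Icc 2 M).filter fun v => ¬ (twos v).Nonempty) =
      Fintype.piFinset fun _ : V => Icc 3 M := by
    ext v
    simp only [Finset.mem_filter, Fintype.mem_piFinset, Finset.mem_Icc,
      Finset.not_nonempty_iff_eq_empty, Finset.eq_empty_iff_forall_notMem, mem_twos]
    refine ⟨fun h i => ?_, fun h => ⟨fun i => ?_, fun i => ?_⟩⟩
    · have := h.1 i; have := h.2 i; omega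
    · have := h i; omega
    · have := h i; omega
  have hsplit := Finset.card_filter_add_card_filter_not
    (s := Fintype.piFinset fun _ : V => Icc 2 M) (fun v => (twos v).Nonempty)
  rw [hcompl] at hsplit
  simpa [minTwo, Fintype.card_piFinset] using hsplit

theorem card_single_two_le (M : ℕ) :
    ((minTwo V M).filter fun v => (twos v).card = 1).card ≤
      Fintype.card V * (M - 2) ^ (Fintype.card V - 1) := by
  have hsub : ((minTwo V M).filter fun v => (twos v).card = 1) ⊆
      univ.biUnion fun p : V => Fintype.piFinset fun i => if i = p then {2} else Icc 3 M := by
    intro v hv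
    obtain ⟨hv, h1⟩ := Finset.mem_filter.1 hv
    obtain ⟨p, hp⟩ := Finset.card_eq_one.1 h1
    have hmem : ∀ i, v i = 2 ↔ i = p := fun i => by
      rw [← mem_twos, hp, Finset.mem_singleton]
    simp only [Finset.mem_biUnion, Finset.mem_univ, true_and, Fintype.mem_piFinset]
    refine ⟨p, fun i => ?_⟩
    have h2 := (mem_minTwo.1 hv).1 i
    split_ifs with hi
    · exact Finset.mem_singleton.2 ((hmem i).2 hi)
    · have : v i ≠ 2 := fun h => hi ((hmem i).1 h)
      rw [Finset.mem_Icc]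
      omega
  refine (Finset.card_le_card hsub).trans (Finset.card_biUnion_le_card_mul _ _ _ fun p _ => ?_)
  rw [Fintype.card_piFinset, ← Finset.mul_prod_erase univ _ (Finset.mem_univ p)]
  rw [Finset.prod_congr rfl (g := fun _ => M - 2)]
  · simp [Finset.card_erase_of_mem]
  · intro i hi
    simp [Finset.ne_of_mem_erase hi]

theorem layer_card_bound {M : ℕ} {H : Finset (Finset V)} {f : ℕ → ℝ} (hH : InclFree H)
    (hne : H.Nonempty) (hf : Objective M f) :
    2 * (M - 1) ^ Fintype.card V ≤ (Zlayer M 1 H f).ncard + 2 * (M - 2) ^ Fintype.card V +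
      Fintype.card V * (M - 2) ^ (Fintype.card V - 1) := by
  have h := (sum_le_card_isoPairs hH hne hf).trans (card_isoPairs_le M H f)
  have hsum : ∑ v ∈ minTwo V M, (if (twos v).card = 1 then 1 else 2) +
      ((minTwo V M).filter fun v => (twos v).card = 1).card = 2 * (minTwo V M).card := by
    rw [Finset.card_filter, ← Finset.sum_add_distrib, mul_comm, ← smul_eq_mul,
      ← Finset.sum_const]
    refine Finset.sum_congr rfl fun v _ => ?_
    split_ifs <;> rfl
  have h1 := card_single_two_le (V := V) M
  have h2 := card_minTwo (V := V) M
  omega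

theorem zlayer_empty {V : Type*} (M j : ℕ) (f : ℕ → ℝ) :
    Zlayer M j (∅ : Finset (Finset V)) f = Zlayer M j {∅} f := by
  have h : ∀ w : V → ℕ, Isolating {∅} f w := fun w =>
    Or.inr ⟨∅, by simp, fun e he => by simpa using he.1⟩
  ext w
  simp only [Zlayer, Zset, Set.mem_ofPred_eq, h w, show Isolating ∅ f w from Or.inl rfl]

end

/-- Theorem 9 of the paper.  For `M ≥ 2`, every inclusion-free
hypergraph `H` on `[n]`, and every objective function `f : [M] → ℝ`,
`|Z_1(H,M,f)| ≥ 2(M-1)^n - 2(M-2)^n - n(M-2)^{n-1}`. -/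
theorem stmt_6 {n M : ℕ} (hM : 2 ≤ M) (H : Finset (Finset (Fin n))) (f : ℕ → ℝ)
    (hH : InclFree H) (hf : Objective M f) :
    2 * ((M : ℤ) - 1) ^ n - 2 * ((M : ℤ) - 2) ^ n - (n : ℤ) * ((M : ℤ) - 2) ^ (n - 1) ≤
      ((Zlayer M 1 H f).ncard : ℤ) := by
  have key : ∀ H : Finset (Finset (Fin n)), InclFree H → H.Nonempty →
      2 * ((M : ℤ) - 1) ^ n - 2 * ((M : ℤ) - 2) ^ n - (n : ℤ) * ((M : ℤ) - 2) ^ (n - 1) ≤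
        ((Zlayer M 1 H f).ncard : ℤ) := by
    intro H hH hne
    have h := layer_card_bound hH hne hf
    rw [Fintype.card_fin] at h
    zify [hM, (by omega : 1 ≤ M)] at h
    linarith
  rcases H.eq_empty_or_nonempty with rfl | hne
  · rw [zlayer_empty]
    exact key {∅} (by simp [InclFree]) (Finset.singleton_nonempty _)
  · exact key H hH hne
end

section
/- Let M ≥ 2, let H be an inclusion-free hypergraph on [n], and let f: [M] → ℝ be strictly increasing with strictly positive values. Then the number of isolating weights satisfies |Z(H,M,f)| ≥ 2(M−1)^n − n · ∑_{i=1}^{M−2} i^{n−1}. -/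
open Finset

open scoped Classical in
/-- Decrease the weight by one on `X`. -/
noncomputable def decOn {V : Type*} (w : V → ℕ) (X : Finset V) : V → ℕ :=
  fun i => if i ∈ X then w i - 1 else w i

open scoped Classical in
/-- Increase the weight by one on `X`. -/
noncomputable def incOn {V : Type*} (w : V → ℕ) (X : Finset V) : V → ℕ :=
  fun i => if i ∈ X then w i + 1 else w i

open scoped Classical in
/-- The set of vertices of minimum weight. -/
noncomputable def argminSet {V : Type*} [Fintype V] (w : V → ℕ) : Finset V :=
  univ.filter fun x => ∀ y, w x ≤ w y

/-- The edge `e` has minimum weight. -/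
def MinEdge {V : Type*} (H : Finset (Finset V)) (f : ℕ → ℝ) (w : V → ℕ) (e : Finset V) : Prop :=
  e ∈ H ∧ ∀ T ∈ H, edgeW f w e ≤ edgeW f w T

/-- The edge `e` is the unique edge of minimum weight. -/
def UniqueMinEdge {V : Type*} (H : Finset (Finset V)) (f : ℕ → ℝ) (w : V → ℕ)
    (e : Finset V) : Prop :=
  e ∈ H ∧ ∀ e' ∈ H, e' ≠ e → edgeW f w e < edgeW f w e'

open scoped Classical in
/-- The unique edge of minimum weight, if there is one. -/
noncomputable def isolatedEdge {V : Type*} (H : Finset (Finset V)) (f : ℕ → ℝ) (w : V → ℕ) :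
    Finset V :=
  if h : ∃ e, UniqueMinEdge H f w e then h.choose else ∅

open scoped Classical in
/-- Increase an isolating weight on its isolated edge and on its minimum vertices. -/
noncomputable def liftWeight {V : Type*} [Fintype V] (H : Finset (Finset V)) (f : ℕ → ℝ)
    (u : V → ℕ) : V → ℕ :=
  incOn u (isolatedEdge H f u ∪ argminSet u)

open scoped Classical in
/-- The weights with values in `{k, …, M}`. -/
noncomputable def weightBox (V : Type*) [Fintype V] (k M : ℕ) : Finset (V → ℕ) :=
  Fintype.piFinset fun _ => Icc k M

open scoped Classical in
/-- The weights in `{1, …, M}` with a unique edge of minimum weight. -/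
noncomputable def isolatingFinset {V : Type*} [Fintype V] (M : ℕ) (H : Finset (Finset V))
    (f : ℕ → ℝ) : Finset (V → ℕ) :=
  (weightBox V 1 M).filter fun u => ∃ e, UniqueMinEdge H f u e

open scoped Classical in
/-- The isolating weights that are lifted to `w`. -/
noncomputable def liftFiber {V : Type*} [Fintype V] (M : ℕ) (H : Finset (Finset V))
    (f : ℕ → ℝ) (w : V → ℕ) : Finset (V → ℕ) :=
  (isolatingFinset M H f).filter fun u => liftWeight H f u = w

/-- A single edge contains all minimum vertices of `w` and is isolated as soon as any one of them
is decreased. -/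
def Dominated {V : Type*} [Fintype V] (H : Finset (Finset V)) (f : ℕ → ℝ) (w : V → ℕ)
    (S : Finset V) : Prop :=
  argminSet w ⊆ S ∧ ∀ x ∈ argminSet w, UniqueMinEdge H f (decOn w {x}) S

open scoped Classical in
/-- Decrease `w` by one at `x` and increase it by `t` on the rest of `S`. -/
noncomputable def tilt {V : Type*} (w : V → ℕ) (S : Finset V) (x : V) (t : ℕ) : V → ℕ :=
  fun i => if i = x then w x - 1 else if i ∈ S then w i + t else w i

section Isolation

variable {V : Type*} [Fintype V] {M : ℕ} {H : Finset (Finset V)} {f : ℕ → ℝ}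

lemma mem_argminSet {w : V → ℕ} {x : V} : x ∈ argminSet w ↔ ∀ y, w x ≤ w y := by
  simp [argminSet]

lemma argminSet_nonempty [Nonempty V] (w : V → ℕ) : (argminSet w).Nonempty := by
  obtain ⟨x, hx⟩ := Finite.exists_min w
  exact ⟨x, mem_argminSet.2 hx⟩

lemma mem_weightBox {k : ℕ} {w : V → ℕ} : w ∈ weightBox V k M ↔ ∀ i, k ≤ w i ∧ w i ≤ M := by
  simp [weightBox]

omit [Fintype V] in
lemma UniqueMinEdge.eq {w : V → ℕ} {S T : Finset V} (hS : UniqueMinEdge H f w S)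
    (hT : UniqueMinEdge H f w T) : S = T := by
  by_contra h
  exact lt_asymm (hS.2 T hT.1 (Ne.symm h)) (hT.2 S hS.1 h)

omit [Fintype V] in
lemma UniqueMinEdge.isolatedEdge_eq {w : V → ℕ} {S : Finset V} (hS : UniqueMinEdge H f w S) :
    isolatedEdge H f w = S := by
  have h : ∃ e, UniqueMinEdge H f w e := ⟨S, hS⟩
  rw [isolatedEdge, dif_pos h]
  exact h.choose_spec.eq hS

omit [Fintype V] in
lemma exists_minEdge (hne : H.Nonempty) (w : V → ℕ) : ∃ e, MinEdge H f w e := by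
  obtain ⟨e, he, h⟩ := H.exists_min_image (edgeW f w) hne
  exact ⟨e, he, h⟩

omit [Fintype V] in
open scoped Classical in
lemma edgeW_decOn (w : V → ℕ) (D T : Finset V) :
    edgeW f (decOn w D) T = edgeW f w T - ∑ i ∈ T ∩ D, (f (w i) - f (w i - 1)) := by
  rw [← filter_mem_eq_inter, sum_filter, edgeW, edgeW, ← sum_sub_distrib]
  refine sum_congr rfl fun i _ => ?_
  by_cases h : i ∈ D <;> simp [decOn, h]

omit [Fintype V] in
lemma MinEdge.uniqueMinEdge_decOn (hf : Objective M f) {w : V → ℕ} {D S : Finset V}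
    (hS : MinEdge H f w S) (hD : D ⊆ S) (hw : ∀ i ∈ D, 2 ≤ w i ∧ w i ≤ M)
    (hT : ∀ T, MinEdge H f w T → T ≠ S → ¬ D ⊆ T) :
    UniqueMinEdge H f (decOn w D) S := by
  classical
  have hpos : ∀ i ∈ D, 0 < f (w i) - f (w i - 1) := fun i hi => by
    have := hw i hi
    exact sub_pos.2 (hf.1 ⟨by omega, by omega⟩ ⟨by omega, by omega⟩ (by omega))
  refine ⟨hS.1, fun T hTH hne => ?_⟩
  rw [edgeW_decOn, edgeW_decOn, inter_eq_right.2 hD]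
  by_cases hDT : D ⊆ T
  · rw [inter_eq_right.2 hDT]
    have : edgeW f w S < edgeW f w T := by
      by_contra h
      exact hT T ⟨hTH, fun e he => (not_lt.1 h).trans (hS.2 e he)⟩ hne hDT
    linarith
  · obtain ⟨i, hi, hiT⟩ := not_subset.1 hDT
    have h1 : ∑ i ∈ T ∩ D, (f (w i) - f (w i - 1)) < ∑ i ∈ D, (f (w i) - f (w i - 1)) :=
      sum_lt_sum_of_subset inter_subset_right hi (by simp [hiT]) (hpos i hi)
        fun j hj _ => (hpos j hj).le
    linarith [hS.2 T hTH]

lemma mem_argminSet_decOn {w : V → ℕ} {X : Finset V} {x : V}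
    (hx : x ∈ argminSet w) (hX : x ∈ X) : x ∈ argminSet (decOn w X) := by
  rw [mem_argminSet] at hx ⊢
  intro y
  have := hx y
  by_cases hy : y ∈ X <;> simp [decOn, hX, hy] <;> omega

lemma argminSet_decOn_subset {w : V → ℕ} (hw : w ∈ weightBox V 2 M) {X : Finset V} {x : V}
    (hx : x ∈ argminSet w) (hX : x ∈ X) : argminSet (decOn w X) ⊆ X := by
  intro y hy
  by_contra hyX
  have h1 := mem_argminSet.1 hx y
  have h2 := mem_argminSet.1 hy x
  have h3 := mem_weightBox.1 hw x
  simp [decOn, hX, hyX] at h2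
  omega

omit [Fintype V] in
lemma incOn_decOn {w : V → ℕ} {X : Finset V} (hw : ∀ i, 1 ≤ w i) :
    incOn (decOn w X) X = w := by
  funext i
  have := hw i
  by_cases h : i ∈ X <;> simp [incOn, decOn, h]
  omega

lemma decOn_mem_weightBox {w : V → ℕ} (hw : w ∈ weightBox V 2 M) (X : Finset V) :
    decOn w X ∈ weightBox V 1 M := by
  rw [mem_weightBox] at hw ⊢
  intro i
  have := hw i
  by_cases h : i ∈ X <;> simp [decOn, h] <;> omega

lemma mem_liftFiber_of_mem {w : V → ℕ} (hw : w ∈ weightBox V 2 M) {x : V}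
    (hx : x ∈ argminSet w) {S : Finset V} (hxS : x ∈ S)
    (hS : UniqueMinEdge H f (decOn w S) S) : decOn w S ∈ liftFiber M H f w := by
  classical
  refine mem_filter.2 ⟨mem_filter.2 ⟨decOn_mem_weightBox hw S, S, hS⟩, ?_⟩
  rw [liftWeight, hS.isolatedEdge_eq]
  have : S ∪ argminSet (decOn w S) = S := union_eq_left.2 (argminSet_decOn_subset hw hx hxS)
  convert incOn_decOn (X := S) fun i => one_le_two.trans (mem_weightBox.1 hw i).1 using 2

open scoped Classical in
lemma mem_liftFiber_of_insert {w : V → ℕ} (hw : w ∈ weightBox V 2 M) {x : V}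
    (hx : x ∈ argminSet w) {S : Finset V}
    (hS : UniqueMinEdge H f (decOn w (insert x S)) S) :
    decOn w (insert x S) ∈ liftFiber M H f w := by
  refine mem_filter.2 ⟨mem_filter.2 ⟨decOn_mem_weightBox hw _, S, hS⟩, ?_⟩
  rw [liftWeight, hS.isolatedEdge_eq]
  have hxX : x ∈ insert x S := mem_insert_self x S
  have h1 := argminSet_decOn_subset hw hx hxX
  have h2 := mem_argminSet_decOn hx hxX
  have : S ∪ argminSet (decOn w (insert x S)) = insert x S := by
    ext y
    constructor
    · intro hy
      rcases mem_union.1 hy with hy | hy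
      · exact mem_insert_of_mem hy
      · exact h1 hy
    · intro hy
      rcases mem_insert.1 hy with rfl | hy
      · exact mem_union_right _ h2
      · exact mem_union_left _ hy
  convert incOn_decOn (X := insert x S) fun i => one_le_two.trans (mem_weightBox.1 hw i).1 using 2

open scoped Classical in
/-- Decreasing a minimum vertex `x` leads either to an isolated edge avoiding `x`, or to minimum
edges all of which contain `x` and can be isolated. -/
lemma exists_isolated_or_forall_minEdge (hH : InclFree H) (hf : Objective M f) {w : V → ℕ}
    (hw : w ∈ weightBox V 2 M) (x : V) :
    (∃ S, x ∉ S ∧ UniqueMinEdge H f (decOn w (insert x S)) S) ∨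
      ∀ T, MinEdge H f (decOn w {x}) T → x ∈ T ∧ UniqueMinEdge H f (decOn w T) T := by
  have hw' := mem_weightBox.1 hw
  by_cases h : ∃ S, MinEdge H f (decOn w {x}) S ∧ x ∉ S
  · obtain ⟨S, hS, hxS⟩ := h
    refine Or.inl ⟨S, hxS, ?_⟩
    have key := hS.uniqueMinEdge_decOn hf Subset.rfl (fun i hi => ?_) fun T hT hne hST =>
      hH S hS.1 T hT.1 (Finset.ssubset_iff_subset_ne.2 ⟨hST, hne.symm⟩)
    · convert key using 1
      funext i
      by_cases hi : i = x
      · subst hi; simp [decOn, hxS]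
      · by_cases hiS : i ∈ S <;> simp [decOn, hi, hiS]
    · have hix : i ≠ x := fun h => hxS (h ▸ hi)
      simpa [decOn, hix] using hw' i
  · push Not at h
    refine Or.inr fun S hS => ⟨h S hS, ?_⟩
    have key := hS.uniqueMinEdge_decOn hf (erase_subset x S) (fun i hi => ?_)
      fun T hT hne hST => hH S hS.1 T hT.1
        (Finset.ssubset_iff_subset_ne.2 ⟨fun i hi => ?_, hne.symm⟩)
    · convert key using 1
      funext i
      by_cases hi : i = x
      · subst hi; simp [decOn, h S hS]
      · by_cases hiS : i ∈ S <;> simp [decOn, hi, hiS]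
    · simpa [decOn, ne_of_mem_erase hi] using hw' i
    · by_cases hix : i = x
      · exact hix ▸ h T hT
      · exact hST (mem_erase.2 ⟨hix, hi⟩)

lemma liftFiber_nonempty [Nonempty V] (hne : H.Nonempty) (hH : InclFree H) (hf : Objective M f)
    {w : V → ℕ} (hw : w ∈ weightBox V 2 M) : (liftFiber M H f w).Nonempty := by
  classical
  obtain ⟨x, hx⟩ := argminSet_nonempty w
  rcases exists_isolated_or_forall_minEdge hH hf hw x with ⟨S, -, hS⟩ | h
  · exact ⟨_, mem_liftFiber_of_insert hw hx hS⟩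
  · obtain ⟨T, hT⟩ := exists_minEdge (f := f) hne (decOn w {x})
    exact ⟨_, mem_liftFiber_of_mem hw hx (h T hT).1 (h T hT).2⟩

lemma two_le_card_liftFiber (hne : H.Nonempty) (hH : InclFree H) (hf : Objective M f)
    {w : V → ℕ} (hw : w ∈ weightBox V 2 M) (hA : 2 ≤ #(argminSet w))
    (hD : ¬ ∃ S, Dominated H f w S) : 2 ≤ #(liftFiber M H f w) := by
  classical
  by_contra hcard
  have hsub : ∀ u ∈ liftFiber M H f w, ∀ v ∈ liftFiber M H f w, u = v :=
    card_le_one.1 (by omega)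
  by_cases ha : ∃ x ∈ argminSet w, ∃ S, x ∉ S ∧ UniqueMinEdge H f (decOn w (insert x S)) S
  · obtain ⟨x, hx, S, hxS, hS⟩ := ha
    obtain ⟨y, hy, hyx⟩ := exists_mem_ne hA x
    have hu := mem_liftFiber_of_insert hw hx hS
    rcases exists_isolated_or_forall_minEdge hH hf hw y with ⟨T, hyT, hT⟩ | h
    · have heq := hsub _ hu _ (mem_liftFiber_of_insert hw hy hT)
      rw [← heq] at hT
      obtain rfl := hS.eq hT
      have h1 := mem_argminSet_decOn hy (mem_insert_self y S)
      rw [← heq] at h1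
      rcases mem_insert.1 (argminSet_decOn_subset hw hx (mem_insert_self x S) h1) with h2 | h2
      · exact hyx h2
      · exact hyT h2
    · obtain ⟨T, hT⟩ := exists_minEdge (f := f) hne (decOn w {y})
      obtain ⟨hyT, hT⟩ := h T hT
      have heq := hsub _ hu _ (mem_liftFiber_of_mem hw hy hyT hT)
      rw [← heq] at hT
      obtain rfl := hS.eq hT
      have h1 := mem_argminSet_decOn hx (mem_insert_self x S)
      rw [heq] at h1
      exact hxS (argminSet_decOn_subset hw hy hyT h1)
  · have hb : ∀ x ∈ argminSet w, ∀ T, MinEdge H f (decOn w {x}) T →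
        x ∈ T ∧ UniqueMinEdge H f (decOn w T) T := fun x hx =>
      (exists_isolated_or_forall_minEdge hH hf hw x).resolve_left fun h => ha ⟨x, hx, h⟩
    obtain ⟨x₀, hx₀⟩ := card_pos.1 (by omega : 0 < #(argminSet w))
    obtain ⟨S, hS⟩ := exists_minEdge (f := f) hne (decOn w {x₀})
    have hall : ∀ x ∈ argminSet w, ∀ T, MinEdge H f (decOn w {x}) T → T = S := by
      intro x hx T hT
      have h1 := hb x hx T hT
      have h2 := hb x₀ hx₀ S hS
      have heq := hsub _ (mem_liftFiber_of_mem hw hx h1.1 h1.2) _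
        (mem_liftFiber_of_mem hw hx₀ h2.1 h2.2)
      exact h1.2.eq (heq ▸ h2.2)
    have hmin : ∀ x ∈ argminSet w, MinEdge H f (decOn w {x}) S := fun x hx => by
      obtain ⟨T, hT⟩ := exists_minEdge (f := f) hne (decOn w {x})
      exact hall x hx T hT ▸ hT
    refine hD ⟨S, fun x hx => (hb x hx S (hmin x hx)).1, fun x hx => ⟨hS.1, fun T hT hTS => ?_⟩⟩
    by_contra hlt
    exact hTS (hall x hx T ⟨hT, fun e he => (not_lt.1 hlt).trans ((hmin x hx).2 e he)⟩)

omit [Fintype V] in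
lemma tilt_zero (w : V → ℕ) (S : Finset V) (x : V) : tilt w S x 0 = decOn w {x} := by
  funext i
  by_cases h : i = x
  · subst h; simp [tilt, decOn]
  · simp [tilt, decOn, h]

lemma argminSet_tilt {w : V → ℕ} (hw : w ∈ weightBox V 2 M) (S : Finset V) {x : V}
    (hx : x ∈ argminSet w) (t : ℕ) : argminSet (tilt w S x t) = {x} := by
  have h2 := (mem_weightBox.1 hw x).1
  rw [mem_argminSet] at hx
  ext y
  rw [mem_argminSet, mem_singleton]
  constructor
  · intro h
    by_contra hyx
    have h1 := h x
    have h3 := hx y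
    by_cases hy : y ∈ S <;> simp [tilt, hyx, hy] at h1 <;> omega
  · rintro rfl z
    have h3 := hx z
    by_cases hz : z = y
    · subst hz; rfl
    · by_cases hzS : z ∈ S <;> simp [tilt, hz, hzS] <;> omega

/-- Tilting a dominated weight as far as possible gives an isolating weight whose lift either
leaves the box or has a unique minimum vertex and at least two isolating weights below it. -/
lemma Dominated.exists_tilt (hne : H.Nonempty) (hH : InclFree H) (hf : Objective M f)
    {w : V → ℕ} (hw : w ∈ weightBox V 2 M) (hA : 2 ≤ #(argminSet w)) {S : Finset V}
    (hD : Dominated H f w S) {x : V} (hx : x ∈ argminSet w) :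
    ∃ t, tilt w S x t ∈ isolatingFinset M H f ∧ UniqueMinEdge H f (tilt w S x t) S ∧
      (liftWeight H f (tilt w S x t) ∈ weightBox V 2 M →
        #(argminSet (liftWeight H f (tilt w S x t))) = 1 ∧
        2 ≤ #(liftFiber M H f (liftWeight H f (tilt w S x t)))) := by
  classical
  have hxS : x ∈ S := hD.1 hx
  have hw' := mem_weightBox.1 hw
  obtain ⟨t, ⟨htM, htS⟩, ht⟩ : ∃ t, (tilt w S x t ∈ weightBox V 1 M ∧
      UniqueMinEdge H f (tilt w S x t) S) ∧ ¬ (tilt w S x (t + 1) ∈ weightBox V 1 M ∧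
      UniqueMinEdge H f (tilt w S x (t + 1)) S) := by
    by_contra! hcon
    have hall : ∀ t, tilt w S x t ∈ weightBox V 1 M ∧ UniqueMinEdge H f (tilt w S x t) S := by
      intro t
      induction t with
      | zero => exact tilt_zero w S x ▸ ⟨decOn_mem_weightBox hw _, hD.2 x hx⟩
      | succ t ih => exact hcon t ih
    obtain ⟨y, hy, hyx⟩ := exists_mem_ne hA x
    have h1 := (mem_weightBox.1 (hall M).1 y).2
    have h2 := (hw' y).1
    simp [tilt, hyx, hD.1 hy] at h1
    omega
  have hmem : tilt w S x t ∈ isolatingFinset M H f := mem_filter.2 ⟨htM, S, htS⟩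
  refine ⟨t, hmem, htS, fun hlift => ?_⟩
  have hval : liftWeight H f (tilt w S x t) =
      fun i => if i = x then w x else if i ∈ S then w i + (t + 1) else w i := by
    rw [liftWeight, htS.isolatedEdge_eq, argminSet_tilt hw S hx]
    funext i
    have := (hw' x).1
    by_cases hi : i = x
    · subst hi; simp [incOn, tilt, hxS]; omega
    · by_cases hiS : i ∈ S <;> simp [incOn, tilt, hi, hiS]; omega
  have hself : tilt w S x t ∈ liftFiber M H f (liftWeight H f (tilt w S x t)) :=
    mem_filter.2 ⟨hmem, rfl⟩
  generalize liftWeight H f (tilt w S x t) = v at hlift hval hself ⊢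
  have hdec : decOn v {x} = tilt w S x (t + 1) := by
    funext i
    rw [hval]
    by_cases hi : i = x
    · subst hi; simp [decOn, tilt]
    · simp [decOn, tilt, hi]
  have harg : argminSet v = {x} := by
    have hx' := mem_argminSet.1 hx
    ext y
    rw [mem_argminSet, mem_singleton, hval]
    constructor
    · intro h
      by_contra hyx
      have h1 := h x
      have h3 := hx' y
      by_cases hy : y ∈ S
      · simp [hyx, hy] at h1; omega
      · simp [hyx, hy] at h1
        exact hy (hD.1 (mem_argminSet.2 fun z => h1.trans (hx' z)))
    · rintro rfl z
      have h3 := hx' z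
      by_cases hz : z = y
      · subst hz; rfl
      · by_cases hzS : z ∈ S <;> simp [hz, hzS] <;> omega
  have hxv : x ∈ argminSet v := by simp [harg]
  have hnot : ¬ UniqueMinEdge H f (decOn v {x}) S := fun h =>
    ht ⟨hdec ▸ decOn_mem_weightBox hlift {x}, hdec ▸ h⟩
  refine ⟨by simp [harg], one_lt_card.2 ?_⟩
  rcases exists_isolated_or_forall_minEdge hH hf hlift x with ⟨T, hxT, hT⟩ | h
  · refine ⟨_, hself, _, mem_liftFiber_of_insert hlift hxv hT, fun heq => ?_⟩
    rw [← heq] at hT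
    exact hxT (htS.eq hT ▸ hxS)
  · obtain ⟨T, hT, hTS⟩ : ∃ T, MinEdge H f (decOn v {x}) T ∧ T ≠ S := by
      by_contra! hcon
      obtain ⟨T, hT⟩ := exists_minEdge (f := f) hne (decOn v {x})
      have hTS := hcon T hT
      subst hTS
      refine hnot ⟨hT.1, fun e he heT => ?_⟩
      by_contra hlt
      exact heT (hcon e ⟨he, fun e' he' => (not_lt.1 hlt).trans (hT.2 e' he')⟩)
    obtain ⟨hxT, hT⟩ := h T hT
    refine ⟨_, hself, _, mem_liftFiber_of_mem hlift hxv hxT hT, fun heq => ?_⟩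
    rw [← heq] at hT
    exact hTS (hT.eq htS)

omit [Fintype V] in
lemma le_of_tilt_eq {w w' : V → ℕ} {S : Finset V} {x y : V} {t t' : ℕ} (hyx : y ≠ x)
    (hy : y ∈ S) (hle : w y ≤ w' y) (h : tilt w S x t = tilt w' S x t') : t' ≤ t := by
  have := congrFun h y
  simp [tilt, hyx, hy] at this
  omega

lemma tilt_injective {w w' : V → ℕ} (hw : w ∈ weightBox V 2 M) (hw' : w' ∈ weightBox V 2 M)
    (hA : 2 ≤ #(argminSet w)) (hA' : 2 ≤ #(argminSet w')) {S : Finset V} {x : V}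
    (hS : argminSet w ⊆ S) (hS' : argminSet w' ⊆ S) (hx : x ∈ argminSet w)
    (hx' : x ∈ argminSet w') {t t' : ℕ} (h : tilt w S x t = tilt w' S x t') : w = w' := by
  have h1 := congrFun h x
  have h2 := (mem_weightBox.1 hw x).1
  have h3 := (mem_weightBox.1 hw' x).1
  simp [tilt] at h1
  obtain ⟨y, hy, hyx⟩ := exists_mem_ne hA x
  obtain ⟨z, hz, hzx⟩ := exists_mem_ne hA' x
  have hyw : w y ≤ w' y := by
    have := mem_argminSet.1 hy x
    have := mem_argminSet.1 hx' y
    omega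
  have hzw : w' z ≤ w z := by
    have := mem_argminSet.1 hz x
    have := mem_argminSet.1 hx z
    omega
  have htt : t = t' :=
    le_antisymm (le_of_tilt_eq hzx (hS' hz) hzw h.symm) (le_of_tilt_eq hyx (hS hy) hyw h)
  funext i
  have hi := congrFun h i
  by_cases hix : i = x
  · subst hix; omega
  · by_cases hiS : i ∈ S <;> simp [tilt, hix, hiS] at hi <;> omega

open scoped Classical in
/-- The dominated weights with at least two minimum vertices. -/
noncomputable def dominatedFinset (M : ℕ) (H : Finset (Finset V)) (f : ℕ → ℝ) :
    Finset (V → ℕ) :=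
  (weightBox V 2 M).filter fun w => 2 ≤ #(argminSet w) ∧ ∃ S, Dominated H f w S

open scoped Classical in
lemma two_mul_card_dominatedFinset_le (hne : H.Nonempty) (hH : InclFree H) (hf : Objective M f) :
    2 * #(dominatedFinset M H f) ≤
      #((isolatingFinset M H f).filter fun u => liftWeight H f u ∉ weightBox V 2 M) +
      ∑ w ∈ (weightBox V 2 M).filter
        (fun w => #(argminSet w) = 1 ∧ 2 ≤ #(liftFiber M H f w)), #(liftFiber M H f w) := by
  have hex : ∀ p ∈ (dominatedFinset M H f).sigma fun w => argminSet w, ∃ S t,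
      Dominated H f p.1 S ∧
      tilt p.1 S p.2 t ∈ isolatingFinset M H f ∧ UniqueMinEdge H f (tilt p.1 S p.2 t) S ∧
      (liftWeight H f (tilt p.1 S p.2 t) ∈ weightBox V 2 M →
        #(argminSet (liftWeight H f (tilt p.1 S p.2 t))) = 1 ∧
        2 ≤ #(liftFiber M H f (liftWeight H f (tilt p.1 S p.2 t)))) := by
    rintro ⟨w, x⟩ hp
    obtain ⟨hw, hx⟩ := mem_sigma.1 hp
    obtain ⟨hw, hA, S, hS⟩ := mem_filter.1 hw
    obtain ⟨t, ht⟩ := hS.exists_tilt hne hH hf hw hA hx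
    exact ⟨S, t, hS, ht⟩
  choose! S t hS hmem huniq hlift using hex
  calc 2 * #(dominatedFinset M H f)
      ≤ ∑ w ∈ dominatedFinset M H f, #(argminSet w) := by
        rw [mul_comm, ← smul_eq_mul]
        exact card_nsmul_le_sum _ _ _ fun w hw => (mem_filter.1 hw).2.1
    _ = #((dominatedFinset M H f).sigma fun w => argminSet w) := (card_sigma _ _).symm
    _ ≤ #(((isolatingFinset M H f).filter fun u => liftWeight H f u ∉ weightBox V 2 M) ∪
          ((weightBox V 2 M).filter
            (fun w => #(argminSet w) = 1 ∧ 2 ≤ #(liftFiber M H f w))).biUnion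
              (liftFiber M H f)) := by
        refine card_le_card_of_injOn (fun p => tilt p.1 (S p) p.2 (t p)) (fun p hp => ?_) ?_
        · by_cases h : liftWeight H f (tilt p.1 (S p) p.2 (t p)) ∈ weightBox V 2 M
          · exact mem_union_right _ (mem_biUnion.2 ⟨_, mem_filter.2 ⟨h, hlift p hp h⟩,
              mem_filter.2 ⟨hmem p hp, rfl⟩⟩)
          · exact mem_union_left _ (mem_filter.2 ⟨hmem p hp, h⟩)
        · rintro ⟨w, x⟩ hp ⟨w', x'⟩ hp' heq
          have hu := huniq _ hp
          have hu' := huniq _ hp'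
          have hd := hS _ hp
          have hd' := hS _ hp'
          obtain ⟨hwd, hx⟩ := mem_sigma.1 hp
          obtain ⟨hw, hA, -⟩ := mem_filter.1 hwd
          obtain ⟨hwd', hx'⟩ := mem_sigma.1 hp'
          obtain ⟨hw', hA', -⟩ := mem_filter.1 hwd'
          dsimp only at heq hu hu' hd hd' hw hw' hx hx' hA hA'
          rw [← heq] at hu'
          have hSS := hu.eq hu'
          rw [← hSS] at heq hd'
          have hxx : x = x' := by
            have := congrArg argminSet heq
            rwa [argminSet_tilt hw _ hx, argminSet_tilt hw' _ hx', singleton_inj] at this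
          subst hxx
          obtain rfl := tilt_injective hw hw' hA hA' hd.1 hd'.1 hx hx' heq
          rfl
    _ ≤ _ := (card_union_le _ _).trans (Nat.add_le_add_left card_biUnion_le _)

/-- Every weight with values in `{2, …, M}` accounts for one isolating weight, and for two if it
has several minimum vertices. -/
lemma sum_min_card_argminSet_le [Nonempty V] (hne : H.Nonempty) (hH : InclFree H)
    (hf : Objective M f) :
    ∑ w ∈ weightBox V 2 M, min (#(argminSet w)) 2 ≤ #(isolatingFinset M H f) := by
  classical
  have hcard : #(isolatingFinset M H f) = ∑ w ∈ weightBox V 2 M, #(liftFiber M H f w) +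
      #((isolatingFinset M H f).filter fun u => liftWeight H f u ∉ weightBox V 2 M) := by
    rw [← card_filter_add_card_filter_not (s := isolatingFinset M H f)
      (fun u => liftWeight H f u ∈ weightBox V 2 M)]
    congr 1
    refine (card_eq_sum_card_fiberwise (t := weightBox V 2 M) (f := liftWeight H f)
      fun u hu => (mem_filter.1 hu).2).trans ?_
    refine sum_congr rfl fun w hw => congrArg card ?_
    ext u
    simp only [liftFiber, mem_filter]
    constructor
    · rintro ⟨⟨h1, -⟩, h2⟩
      exact ⟨h1, h2⟩
    · rintro ⟨h1, h2⟩
      exact ⟨⟨h1, h2 ▸ hw⟩, h2⟩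
  have hdom := two_mul_card_dominatedFinset_le hne hH hf
  rw [dominatedFinset, card_filter, sum_filter] at hdom
  have hpt : ∑ w ∈ weightBox V 2 M, (2 * min (#(argminSet w)) 2 +
      if #(argminSet w) = 1 ∧ 2 ≤ #(liftFiber M H f w) then #(liftFiber M H f w) else 0) ≤
      ∑ w ∈ weightBox V 2 M, (2 * #(liftFiber M H f w) +
        2 * if 2 ≤ #(argminSet w) ∧ ∃ S, Dominated H f w S then 1 else 0) := by
    refine sum_le_sum fun w hw => ?_
    have h1 : 0 < #(liftFiber M H f w) := card_pos.2 (liftFiber_nonempty hne hH hf hw)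
    have h2 : 0 < #(argminSet w) := card_pos.2 (argminSet_nonempty w)
    have h3 := two_le_card_liftFiber hne hH hf hw
    by_cases hA : 2 ≤ #(argminSet w)
    · rw [if_neg (by omega)]
      by_cases hS : ∃ S, Dominated H f w S
      · rw [if_pos ⟨hA, hS⟩]; omega
      · have := h3 hA hS
        omega
    · split_ifs <;> omega
  simp only [sum_add_distrib, ← mul_sum] at hpt
  omega

end Isolation

lemma card_filter_argminSet_le {n M : ℕ} (hn : 2 ≤ n) :
    #((weightBox (Fin n) 2 M).filter fun w => #(argminSet w) = 1) ≤
      n * ∑ i ∈ Icc 1 (M - 2), i ^ (n - 1) := by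
  classical
  calc _ ≤ #((univ : Finset (Fin n)).biUnion fun x => (Icc 1 (M - 2)).biUnion fun i =>
        Fintype.piFinset fun y => if y = x then {M - i} else Icc (M - i + 1) M) := by
        refine card_le_card fun w hw => ?_
        obtain ⟨hw, hA⟩ := mem_filter.1 hw
        obtain ⟨x, hx⟩ := card_eq_one.1 hA
        rw [mem_weightBox] at hw
        have hlt : ∀ y, y ≠ x → w x < w y := fun y hy => by
          by_contra h
          have hxm : ∀ z, w x ≤ w z := mem_argminSet.1 (by simp [hx])
          have : y ∈ argminSet w := mem_argminSet.2 fun z => (not_lt.1 h).trans (hxm z)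
          rw [hx, mem_singleton] at this
          exact hy this
        have : Nontrivial (Fin n) := Fin.nontrivial_iff_two_le.2 hn
        obtain ⟨y, hy⟩ := exists_ne x
        have h1 := hlt y hy
        have h2 := hw y
        have h3 := hw x
        simp only [mem_biUnion, mem_univ, true_and, Fintype.mem_piFinset]
        refine ⟨x, M - w x, mem_Icc.2 ⟨by omega, by omega⟩, fun z => ?_⟩
        by_cases hz : z = x
        · subst hz; simp; omega
        · have := hlt z hz
          have := hw z
          rw [if_neg hz, mem_Icc]
          omega
    _ ≤ ∑ _x : Fin n, ∑ i ∈ Icc 1 (M - 2), i ^ (n - 1) := by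
        refine card_biUnion_le.trans (sum_le_sum fun x _ => card_biUnion_le.trans
          (sum_le_sum fun i hi => le_of_eq ?_))
        rw [mem_Icc] at hi
        rw [Fintype.card_piFinset, ← mul_prod_erase univ _ (mem_univ x), if_pos rfl,
          card_singleton, one_mul, prod_congr rfl (g := fun _ => i), prod_const,
          card_erase_of_mem (mem_univ x), card_univ, Fintype.card_fin]
        intro y hy
        rw [if_neg (ne_of_mem_erase hy), Nat.card_Icc]
        omega
    _ = _ := by simp

lemma isolatingFinset_subset_Zset {V : Type*} [Fintype V] {M : ℕ} {H : Finset (Finset V)}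
    {f : ℕ → ℝ} : (isolatingFinset M H f : Set (V → ℕ)) ⊆ Zset M H f := by
  classical
  intro u hu
  obtain ⟨hu, e, he⟩ := mem_filter.1 (mem_coe.1 hu)
  exact ⟨mem_weightBox.1 hu, Or.inr ⟨e, he, fun e' he' => UniqueMinEdge.eq he' he⟩⟩

lemma Zset_subset_weightBox {V : Type*} [Fintype V] {M : ℕ} {H : Finset (Finset V)}
    {f : ℕ → ℝ} : Zset M H f ⊆ (weightBox V 1 M : Set (V → ℕ)) :=
  fun _ hw => mem_coe.2 (mem_weightBox.2 hw.1)

lemma finite_Zset {V : Type*} [Fintype V] {M : ℕ} {H : Finset (Finset V)} {f : ℕ → ℝ} :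
    (Zset M H f).Finite :=
  (finite_toSet _).subset Zset_subset_weightBox

lemma Isolating.of_subsingleton {V : Type*} {H : Finset (Finset V)} {f : ℕ → ℝ}
    (h : ∀ e ∈ H, ∀ e' ∈ H, e = e') (w : V → ℕ) : Isolating H f w := by
  rcases H.eq_empty_or_nonempty with rfl | ⟨e, he⟩
  · exact Or.inl rfl
  · exact Or.inr ⟨e, ⟨he, fun e' he' hne => absurd (h e' he' e he) hne⟩,
      fun e' he' => h e' he'.1 e he⟩

lemma card_weightBox {n : ℕ} (k M : ℕ) : #(weightBox (Fin n) k M) = (M + 1 - k) ^ n := by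
  simp [weightBox]

lemma le_ncard_Zset_of_nonempty {n M : ℕ} (hn : 2 ≤ n) (hM : 2 ≤ M)
    {H : Finset (Finset (Fin n))} {f : ℕ → ℝ} (hne : H.Nonempty) (hH : InclFree H)
    (hf : Objective M f) :
    2 * ((M : ℤ) - 1) ^ n - (n : ℤ) * ∑ i ∈ Finset.Icc 1 (M - 2), (i : ℤ) ^ (n - 1) ≤
      ((Zset M H f).ncard : ℤ) := by
  classical
  have : Nonempty (Fin n) := ⟨⟨0, by omega⟩⟩
  have h1 := sum_min_card_argminSet_le hne hH hf
  have h2 : #(isolatingFinset M H f) ≤ (Zset M H f).ncard := by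
    rw [← Set.ncard_coe_finset]
    exact Set.ncard_le_ncard isolatingFinset_subset_Zset finite_Zset
  have h3 := card_filter_argminSet_le (M := M) hn
  have h4 : 2 * #(weightBox (Fin n) 2 M) ≤ ∑ w ∈ weightBox (Fin n) 2 M, min (#(argminSet w)) 2 +
      #((weightBox (Fin n) 2 M).filter fun w => #(argminSet w) = 1) := by
    rw [card_filter, ← sum_add_distrib, mul_comm, ← smul_eq_mul]
    refine card_nsmul_le_sum _ _ _ fun w _ => ?_
    have := card_pos.2 (argminSet_nonempty w)
    split_ifs <;> omega
  rw [card_weightBox] at h4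
  have h5 : 2 * (M - 1) ^ n ≤ (Zset M H f).ncard + n * ∑ i ∈ Icc 1 (M - 2), i ^ (n - 1) := by
    have : M + 1 - 2 = M - 1 := by omega
    rw [this] at h4
    omega
  zify [show 1 ≤ M by omega] at h5
  linarith

/-- Corollary 10 of the paper.  For `M ≥ 2`, every inclusion-free
hypergraph `H` on `[n]` (`n ≥ 1`), and every objective function `f : [M] → ℝ`,
`|Z(H,M,f)| ≥ 2(M-1)^n - n ∑_{i=1}^{M-2} i^{n-1}`. -/
theorem stmt_7 {n M : ℕ} (hn : 1 ≤ n) (hM : 2 ≤ M) (H : Finset (Finset (Fin n)))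
    (f : ℕ → ℝ) (hH : InclFree H) (hf : Objective M f) :
    2 * ((M : ℤ) - 1) ^ n - (n : ℤ) * ∑ i ∈ Finset.Icc 1 (M - 2), (i : ℤ) ^ (n - 1) ≤
      ((Zset M H f).ncard : ℤ) := by
  rcases hn.eq_or_lt with rfl | hn
  · have hsub : ∀ e ∈ H, ∀ e' ∈ H, e = e' := by
      intro e he e' he'
      by_contra hne
      rcases e.eq_empty_or_nonempty with rfl | h
      · exact hH _ he _ he' (empty_ssubset.2 (nonempty_iff_ne_empty.2 (Ne.symm hne)))
      rcases e'.eq_empty_or_nonempty with rfl | h'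
      · exact hH _ he' _ he (empty_ssubset.2 h)
      · exact hne (h.eq_univ.trans h'.eq_univ.symm)
    have hZ : Zset M H f = (weightBox (Fin 1) 1 M : Set (Fin 1 → ℕ)) :=
      Zset_subset_weightBox.antisymm fun w hw =>
        ⟨mem_weightBox.1 (mem_coe.1 hw), Isolating.of_subsingleton hsub w⟩
    rw [hZ, Set.ncard_coe_finset, card_weightBox]
    obtain ⟨m, rfl⟩ := Nat.exists_eq_add_of_le hM
    simp
    linarith
  · rcases H.eq_empty_or_nonempty with rfl | hne
    · have hZ : Zset M (∅ : Finset (Finset (Fin n))) f = Zset M {∅} f := by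
        ext w
        exact and_congr_right fun _ => ⟨fun _ => Isolating.of_subsingleton (by simp) w,
          fun _ => Or.inl rfl⟩
      rw [hZ]
      exact le_ncard_Zset_of_nonempty hn hM (singleton_nonempty _)
        (by simp [InclFree]) hf
    · exact le_ncard_Zset_of_nonempty hn hM hne hH hf
end

section
/- Let H be an inclusion-free hypergraph on [n] and suppose v ∈ [n] has degree zero (no edge of H contains v). Then for every strictly increasing f: [M] → ℝ with positive values, |Z_1(H,M,f)| ≥ M·|Z_1(H−v, M, f)| + ∑_{j=2}^{M} |Z_j(H−v, M, f)|, where H−v is the hypergraph induced on [n]∖{v}. -/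
open Finset

/-- Isolation pulls back along a weight-preserving map that is injective on edges. -/
theorem Isolating.of_image {V W : Type*} [DecidableEq W] {H : Finset (Finset V)}
    {f : ℕ → ℝ} {w : V → ℕ} {u : W → ℕ} (r : Finset V → Finset W)
    (hr : Set.InjOn r H) (hw : ∀ e ∈ H, edgeW f w e = edgeW f u (r e))
    (h : Isolating (H.image r) f u) : Isolating H f w := by
  rcases h with h | ⟨e₀, ⟨he₀, hmin⟩, -⟩
  · exact Or.inl (Finset.image_eq_empty.mp h)
  · obtain ⟨e, he, rfl⟩ := Finset.mem_image.mp he₀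
    have key : ∀ e' ∈ H, e' ≠ e → edgeW f w e < edgeW f w e' := fun e' he' hne => by
      rw [hw e he, hw e' he']
      exact hmin _ (Finset.mem_image_of_mem r he') fun h => hne (hr he' he h)
    refine Or.inr ⟨e, ⟨he, key⟩, fun e' h' => ?_⟩
    by_contra hne
    exact lt_asymm (key e' h'.1 hne) (h'.2 e he (Ne.symm hne))

/-- Extend a weight on the vertices other than `v` by the value `k` at `v`. -/
def extendWeight {V : Type*} [DecidableEq V] (v : V) (k : ℕ) (u : {i // i ≠ v} → ℕ) : V → ℕ :=
  fun i => if h : i ≠ v then u ⟨i, h⟩ else k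

@[simp]
theorem extendWeight_self {V : Type*} [DecidableEq V] (v : V) (k : ℕ) (u : {i // i ≠ v} → ℕ) :
    extendWeight v k u v = k := by
  simp [extendWeight]

@[simp]
theorem extendWeight_coe {V : Type*} [DecidableEq V] (v : V) (k : ℕ) (u : {i // i ≠ v} → ℕ)
    (i : {i // i ≠ v}) : extendWeight v k u i = u i := by
  simp [extendWeight, i.2]

theorem forall_extendWeight {V : Type*} [DecidableEq V] {v : V} {k : ℕ} {u : {i // i ≠ v} → ℕ}
    {p : ℕ → Prop} (hk : p k) (hu : ∀ i, p (u i)) (i : V) : p (extendWeight v k u i) := by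
  by_cases h : i = v
  · simpa [h] using hk
  · simpa [extendWeight, h] using hu ⟨i, h⟩

theorem Isolating.extendWeight {V : Type*} [DecidableEq V] {v : V} {H : Finset (Finset V)}
    (hv : ∀ e ∈ H, v ∉ e) {f : ℕ → ℝ} {k : ℕ} {u : {i // i ≠ v} → ℕ}
    (h : Isolating ((H.filter fun e => v ∉ e).image fun e => e.subtype (· ≠ v)) f u) :
    Isolating H f (extendWeight v k u) := by
  rw [Finset.filter_true_of_mem hv] at h
  have hmem : ∀ e ∈ H, ∀ i ∈ e, i ≠ v := fun e he i hi hiv => hv e he (hiv ▸ hi)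
  refine h.of_image _ (fun e he e' he' hee => ?_) fun e he => ?_
  · have hmap := congrArg (Finset.map (Function.Embedding.subtype (· ≠ v))) hee
    rwa [Finset.subtype_map_of_mem (hmem e he), Finset.subtype_map_of_mem (hmem e' he')] at hmap
  · unfold edgeW
    rw [← Finset.sum_subtype_of_mem _ (hmem e he)]
    simp

theorem finite_Zlayer {V : Type*} [Finite V] (M j : ℕ) (H : Finset (Finset V)) (f : ℕ → ℝ) :
    (Zlayer M j H f).Finite :=
  (Set.Finite.pi' fun _ : V => Set.finite_Icc 1 M).subset fun _ hw => hw.1.1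

theorem disjoint_Zlayer {V : Type*} {M j j' : ℕ} (hj : j ≠ j') (H : Finset (Finset V))
    (f : ℕ → ℝ) : Disjoint (Zlayer M j H f) (Zlayer M j' H f) := by
  rw [Set.disjoint_left]
  rintro w ⟨-, h, i, hi⟩ ⟨-, h', i', hi'⟩
  exact hj (le_antisymm (hi' ▸ h i') (hi ▸ h' i))

/-- Proposition 12 of the paper.  If vertex `v` has degree zero in
the inclusion-free hypergraph `H` on `[n]`, then
`|Z_1(H,M,f)| ≥ M·|Z_1(H-v,M,f)| + ∑_{j=2}^{M} |Z_j(H-v,M,f)|`,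
where `H - v` is the hypergraph induced on `[n] ∖ {v}`. -/
theorem stmt_9 {n M : ℕ} (v : Fin n) (H : Finset (Finset (Fin n))) (f : ℕ → ℝ)
    (hH : InclFree H) (hv : ∀ e ∈ H, v ∉ e) (hf : Objective M f) :
    M * (Zlayer M 1 ((H.filter fun e => v ∉ e).image fun e => e.subtype (· ≠ v)) f).ncard
        + ∑ j ∈ Finset.Icc 2 M,
            (Zlayer M j ((H.filter fun e => v ∉ e).image fun e => e.subtype (· ≠ v)) f).ncard
      ≤ (Zlayer M 1 H f).ncard := by
  classical
  set H' := (H.filter fun e => v ∉ e).image fun e => e.subtype (· ≠ v)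
  let A : ℕ → Finset ({i // i ≠ v} → ℕ) := fun j => (finite_Zlayer M j H' f).toFinset
  have hA : ∀ j u, u ∈ A j ↔ u ∈ Zlayer M j H' f := fun j u => Set.Finite.mem_toFinset _
  have hcard : ∀ j, (Zlayer M j H' f).ncard = (A j).card := fun j =>
    Set.ncard_eq_toFinset_card _ _
  have hdisj : ∀ j j', j ≠ j' → Disjoint (A j) (A j') := fun j j' hj =>
    Set.Finite.disjoint_toFinset.mpr (disjoint_Zlayer hj H' f)
  let S := Finset.Icc 1 M ×ˢ A 1 ∪ {1} ×ˢ (Finset.Icc 2 M).biUnion A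
  have hS : S.card = M * (A 1).card + ∑ j ∈ Finset.Icc 2 M, (A j).card := by
    rw [Finset.card_union_of_disjoint, Finset.card_product, Finset.card_product,
      Finset.card_biUnion fun j _ j' _ hj => hdisj j j' hj]
    · simp
    · refine Finset.disjoint_product.mpr (Or.inr ?_)
      refine (Finset.disjoint_biUnion_right _ _ _).mpr fun j hj => hdisj 1 j ?_
      have := (Finset.mem_Icc.mp hj).1
      omega
  simp only [hcard]
  rw [← hS, Set.ncard_eq_toFinset_card _ (finite_Zlayer M 1 H f)]
  refine Finset.card_le_card_of_injOn (fun p => extendWeight v p.1 p.2) ?_ ?_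
  · rintro ⟨k, u⟩ hp
    rw [Set.Finite.coe_toFinset]
    rcases Finset.mem_union.mp hp with hp | hp
    · obtain ⟨hk, hu⟩ := Finset.mem_product.mp hp
      obtain ⟨⟨hb, hiso⟩, -, i, hi⟩ := (hA _ _).mp hu
      have hb' := forall_extendWeight (p := fun x => 1 ≤ x ∧ x ≤ M) (Finset.mem_Icc.mp hk) hb
      exact ⟨⟨hb', hiso.extendWeight hv⟩, fun i => (hb' i).1, i, by simpa using hi⟩
    · obtain ⟨hk, hu⟩ := Finset.mem_product.mp hp
      obtain rfl : k = 1 := Finset.mem_singleton.mp hk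
      obtain ⟨j, hj, hu⟩ := Finset.mem_biUnion.mp hu
      obtain ⟨⟨hb, hiso⟩, -⟩ := (hA _ _).mp hu
      have hM := Finset.mem_Icc.mp hj
      have hb' := forall_extendWeight (p := fun x => 1 ≤ x ∧ x ≤ M) (k := 1)
        ⟨le_rfl, by omega⟩ hb
      exact ⟨⟨hb', hiso.extendWeight hv⟩, fun i => (hb' i).1, v, by simp⟩
  · rintro ⟨k, u⟩ - ⟨k', u'⟩ - h
    refine Prod.ext ?_ (funext fun i => ?_)
    · simpa using congrFun h v
    · simpa using congrFun h i
end

section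
/- Let H be a non-empty inclusion-free hypergraph on [n], let r be the minimum cardinality of the edges of H, and let H_r be the subhypergraph consisting of the edges of H of cardinality exactly r. Then for every strictly increasing function f: [2] → ℝ with strictly positive values, every special isolating weight for H_r is an isolating weight for H with respect to f; that is, Z'(H_r) ⊆ Z(H, 2, f). -/
open Finset

/-- A weight `w : V → {1,2}` is a *special isolating weight* for `H` if there is an
edge `e ∈ H` such that (1) `w(i) ≤ w(j)` for all `i ∈ e`, `j ∉ e`, and (2) every other
edge has strictly larger weight `w(e') > w(e)`. -/
def SpecialIso {V : Type*} (H : Finset (Finset V)) (w : V → ℕ) : Prop :=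
  (∀ i, 1 ≤ w i ∧ w i ≤ 2) ∧
    ∃ e ∈ H, (∀ i ∈ e, ∀ j, j ∉ e → w i ≤ w j) ∧
      ∀ e' ∈ H, e' ≠ e → ∑ i ∈ e, w i < ∑ i ∈ e', w i

/-- `Z'(H)`: the set of special isolating weights for `H`. -/
def Zprime {V : Type*} (H : Finset (Finset V)) : Set (V → ℕ) :=
  {w | SpecialIso H w}

/-- If `g` is at most `c` on `s` and at least `c` off `s`, with `c > 0`, then any set larger
than `s` has a larger sum. -/
theorem sum_lt_sum_of_card_lt_of_threshold {V : Type*} [DecidableEq V] {s t : Finset V}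
    {g : V → ℝ} {c : ℝ} (hc : 0 < c) (hs : ∀ i ∈ s, g i ≤ c) (ht : ∀ j, j ∉ s → c ≤ g j)
    (hcard : s.card < t.card) : ∑ i ∈ s, g i < ∑ i ∈ t, g i := by
  have hs' : ∑ i ∈ s \ t, g i ≤ (s \ t).card * c := by
    simpa using Finset.sum_le_card_nsmul (s \ t) g c fun i hi => hs i (mem_sdiff.1 hi).1
  have ht' : (t \ s).card * c ≤ ∑ i ∈ t \ s, g i := by
    simpa using Finset.card_nsmul_le_sum (t \ s) g c fun i hi => ht i (mem_sdiff.1 hi).2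
  have hlt : ((s \ t).card : ℝ) < (t \ s).card := by
    have h₁ := card_sdiff_add_card_inter s t
    have h₂ := card_sdiff_add_card_inter t s
    rw [inter_comm] at h₂
    exact_mod_cast (by omega : (s \ t).card < (t \ s).card)
  have hsum := mul_lt_mul_of_pos_right hlt hc
  have h₁ := sum_inter_add_sum_sdiff s t g
  have h₂ := sum_inter_add_sum_sdiff t s g
  rw [inter_comm] at h₂
  linarith

/-- For weights with values in `{1, 2}`, `edgeW` is an affine function of the total weight. -/
theorem edgeW_eq_of_two {V : Type*} (f : ℕ → ℝ) {w : V → ℕ} (hw : ∀ i, 1 ≤ w i ∧ w i ≤ 2)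
    (e : Finset V) :
    edgeW f w e = e.card * (2 * f 1 - f 2) + (f 2 - f 1) * (∑ i ∈ e, w i : ℕ) := by
  have h : ∀ i ∈ e, f (w i) = (2 * f 1 - f 2) + (f 2 - f 1) * w i := by
    intro i _
    obtain hi | hi : w i = 1 ∨ w i = 2 := by have := hw i; omega
    all_goals rw [hi]; push_cast; ring
  rw [edgeW, Finset.sum_congr rfl h, Finset.sum_add_distrib, ← Finset.mul_sum]
  simp only [sum_const, nsmul_eq_mul, Nat.cast_sum]

/-- Proposition 17 of the paper.  Let `H` be a non-empty
inclusion-free hypergraph on `[n]`, let `r` be the minimum cardinality of its edges,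
and let `H_r` consist of the edges of cardinality exactly `r`.  Then for every
objective function `f : [2] → ℝ` we have `Z'(H_r) ⊆ Z(H, 2, f)`. -/
theorem stmt_13 {n : ℕ} (H : Finset (Finset (Fin n))) (hne : H.Nonempty)
    (hH : InclFree H) (r : ℕ)
    (hr1 : ∀ e ∈ H, r ≤ e.card) (hr2 : ∃ e ∈ H, e.card = r)
    (f : ℕ → ℝ) (hf : Objective 2 f) :
    Zprime (H.filter fun e => e.card = r) ⊆ Zset 2 H f := by
  rintro w ⟨hw, e, he, hle, hmin⟩
  obtain ⟨heH, her⟩ := mem_filter.1 he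
  have h12 : f 1 < f 2 := hf.1 (by simp) (by simp) (by norm_num)
  have hw2 : ∀ i, w i = 1 ∨ w i = 2 := fun i => by have := hw i; omega
  have hthreshold : ∃ c, 0 < c ∧ (∀ i ∈ e, f (w i) ≤ c) ∧ ∀ j, j ∉ e → c ≤ f (w j) := by
    by_cases h : ∃ i ∈ e, w i = 2
    · obtain ⟨i, hi, hi2⟩ := h
      refine ⟨f 2, hf.2 2 (by simp), fun k _ => ?_, fun j hj => ?_⟩
      · rcases hw2 k with hk | hk <;> rw [hk]
        exact h12.le
      · have := hle i hi j hj
        rw [show w j = 2 by have := hw j; omega]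
    · push Not at h
      refine ⟨f 1, hf.2 1 (by simp), fun i hi => ?_, fun j _ => ?_⟩
      · rw [(hw2 i).resolve_right (h i hi)]
      · rcases hw2 j with hj | hj <;> rw [hj]
        exact h12.le
  have hiso : ∀ e' ∈ H, e' ≠ e → edgeW f w e < edgeW f w e' := by
    intro e' he' hne'
    rcases (hr1 e' he').eq_or_lt with hr | hr
    · rw [edgeW_eq_of_two f hw, edgeW_eq_of_two f hw, her, ← hr]
      have hlt : ((∑ i ∈ e, w i : ℕ) : ℝ) < (∑ i ∈ e', w i : ℕ) := by
        exact_mod_cast hmin e' (mem_filter.2 ⟨he', hr.symm⟩) hne'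
      have := mul_lt_mul_of_pos_left hlt (sub_pos.2 h12)
      linarith
    · obtain ⟨c, hc, hs, ht⟩ := hthreshold
      exact sum_lt_sum_of_card_lt_of_threshold hc hs ht (her ▸ hr)
  refine ⟨hw, Or.inr ⟨e, ⟨heH, hiso⟩, ?_⟩⟩
  rintro e' ⟨he', hiso'⟩
  by_contra hne'
  exact lt_asymm (hiso e' he' hne') (hiso' e heH (Ne.symm hne'))
end

section
/- Let H be a non-empty hypergraph on [n] all of whose edges have cardinality exactly r. Then the number of special isolating weights satisfies |Z'(H)| ≥ n. -/
open Finset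

open scoped symmDiff

/-- If a finite family of sets contains `∅` and from each of its members one can stay inside the
family by toggling any `v ∈ B` together with a suitable second element, then it has at least
`#B` members. -/
theorem card_le_card_of_toggle_pair_of_empty_mem {V : Type*} [DecidableEq V]
    (F : Finset (Finset V)) (B : Finset V) (h0 : ∅ ∈ F)
    (hF : ∀ s ∈ F, ∀ v ∈ B, ∃ u, u ≠ v ∧ s ∆ {v, u} ∈ F) : #B ≤ #F := by
  have hstep : ∀ s ∈ F, ∃ f : V → V, ∀ v ∈ B, f v ≠ v ∧ s ∆ {v, f v} ∈ F := by
    intro s hs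
    have : ∀ v, ∃ u, v ∈ B → u ≠ v ∧ s ∆ {v, u} ∈ F := fun v => by
      by_cases hv : v ∈ B
      · obtain ⟨u, hu⟩ := hF s hs v hv
        exact ⟨u, fun _ => hu⟩
      · exact ⟨v, fun h => absurd h hv⟩
    choose f hf using this
    exact ⟨f, hf⟩
  obtain ⟨f, hf⟩ := hstep ∅ h0
  have hfF : ∀ v ∈ B, ({v, f v} : Finset V) ∈ F := fun v hv => by
    have := (hf v hv).2
    rwa [← bot_eq_empty, bot_symmDiff] at this
  have hpair : ∀ x y : V, ({x, f x} : Finset V) = {y, f y} → x = y ∨ (x = f y ∧ y = f x) := by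
    intro x y h
    have h1 : x ∈ ({y, f y} : Finset V) := h ▸ mem_insert_self _ _
    have h2 : y ∈ ({x, f x} : Finset V) := h ▸ mem_insert_self _ _
    simp only [mem_insert, mem_singleton] at h1 h2
    grind
  have hfiber : ∀ (g : V → V) (T : Finset V) (t : Finset V),
      #T ≤ 2 * #(T.image fun x => t ∆ {x, g x}) := by
    intro g T t
    refine card_le_mul_card_image _ _ fun a _ => ?_
    obtain h | ⟨y, hy⟩ := (T.filter fun x => t ∆ {x, g x} = a).eq_empty_or_nonempty
    · simp [h]
    · refine (card_le_card fun x hx => ?_).trans (card_le_two (a := y) (b := g y))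
      rw [mem_filter] at hx hy
      have : ({x, g x} : Finset V) = {y, g y} :=
        symmDiff_right_injective t (hx.2.trans hy.2.symm)
      exact this ▸ mem_insert_self _ _
  set T := B.filter fun x => f x ∈ B ∧ f (f x) = x with hT
  have hTB : T ⊆ B := filter_subset _ _
  have hinj : #((B \ T).image fun x => ({x, f x} : Finset V)) = #(B \ T) := by
    refine card_image_of_injOn fun x hx y hy h => ?_
    have := hpair x y h
    simp only [hT, coe_sdiff, Set.mem_sdiff, mem_coe, mem_filter] at hx hy
    grind
  have hsub1 : ((B \ T).image fun x => ({x, f x} : Finset V)) ⊆ F := by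
    intro s hs
    obtain ⟨x, hx, rfl⟩ := mem_image.1 hs
    exact hfF x (mem_sdiff.1 hx).1
  have hBT := card_sdiff_add_card_eq_card hTB
  obtain hTe | ⟨u, hu⟩ := T.eq_empty_or_nonempty
  · have := card_le_card hsub1
    rw [hinj] at this
    simp only [hTe, card_empty] at hBT this
    omega
  have hu' := (mem_filter.1 hu).2
  have huB := hTB hu
  obtain ⟨g, hg⟩ := hstep {u, f u} (hfF u huB)
  have hfT : f u ∈ T := by
    rw [hT, mem_filter, hu'.2]
    exact ⟨hu'.1, huB, rfl⟩
  set T' := T \ {u, f u} with hT'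
  have hT'card : #T ≤ #T' + 2 := by
    have h1 : #T - #{u, f u} ≤ #T' := le_card_sdiff _ _
    have h2 := card_le_two (a := u) (b := f u)
    omega
  set P₁ := (B \ T).image fun x => ({x, f x} : Finset V)
  set P₂ := T.image fun x => (∅ : Finset V) ∆ {x, f x}
  set P₃ := T'.image fun x => ({u, f u} : Finset V) ∆ {x, g x}
  have hfib₂ : #T ≤ 2 * #P₂ := hfiber f T ∅
  have hfib₃ : #T' ≤ 2 * #P₃ := hfiber g T' {u, f u}
  have hP₂ : ∀ s ∈ P₂, ∃ x ∈ T, s = {x, f x} := by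
    intro s hs
    obtain ⟨x, hx, rfl⟩ := mem_image.1 hs
    exact ⟨x, hx, by rw [← bot_eq_empty, bot_symmDiff]⟩
  have hd₁ : Disjoint P₁ P₂ := by
    refine disjoint_left.2 fun s h1 h2 => ?_
    obtain ⟨x, hx, rfl⟩ := mem_image.1 h1
    obtain ⟨y, hy, h⟩ := hP₂ _ h2
    have := hpair x y h
    simp only [hT, mem_sdiff, mem_filter] at hx hy
    grind
  have hP₁₂ : ∀ s ∈ P₁ ∪ P₂, ∃ x ∈ B, s = {x, f x} := by
    intro s hs
    obtain h | h := mem_union.1 hs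
    · obtain ⟨x, hx, rfl⟩ := mem_image.1 h
      exact ⟨x, (mem_sdiff.1 hx).1, rfl⟩
    · obtain ⟨x, hx, rfl⟩ := hP₂ s h
      exact ⟨x, hTB hx, rfl⟩
  have hd₂ : Disjoint (P₁ ∪ P₂) P₃ := by
    refine disjoint_left.2 fun s h1 h2 => ?_
    obtain ⟨x, hx, rfl⟩ := hP₁₂ _ h1
    obtain ⟨y, hy, h⟩ := mem_image.1 h2
    simp only [hT', hT, mem_sdiff, mem_filter, mem_insert, mem_singleton, not_or] at hy
    have hgy := (hg y hy.1.1).1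
    have hfu := (hf u huB).1
    have key : ∀ z, (z ∈ ({u, f u} : Finset V) ∆ {y, g y} ↔ z ∈ ({x, f x} : Finset V)) :=
      fun z => by rw [h]
    simp only [mem_symmDiff, mem_insert, mem_singleton] at key
    have k1 := key u
    have k2 := key (f u)
    have k3 := key y
    have k4 := key (g y)
    grind
  have hd₃ : Disjoint {∅} (P₁ ∪ P₂ ∪ P₃) := by
    rw [disjoint_singleton_left]
    intro h
    obtain h | h := mem_union.1 h
    · obtain ⟨x, -, hx⟩ := hP₁₂ _ h
      exact (insert_ne_empty _ _) hx.symm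
    · obtain ⟨y, hy, h⟩ := mem_image.1 h
      have h' : ({u, f u} : Finset V) = {y, g y} := symmDiff_eq_bot.1 h
      exact (mem_sdiff.1 hy).2 (h' ▸ mem_insert_self _ _)
  have hsub : {∅} ∪ (P₁ ∪ P₂ ∪ P₃) ⊆ F := by
    refine union_subset (singleton_subset_iff.2 h0) (union_subset ?_ ?_)
    · intro s hs
      obtain ⟨x, hx, rfl⟩ := hP₁₂ s hs
      exact hfF x hx
    · intro s hs
      obtain ⟨y, hy, rfl⟩ := mem_image.1 hs
      exact (hg y (hTB (mem_sdiff.1 hy).1)).2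
  have := card_le_card hsub
  rw [card_union_of_disjoint hd₃, card_union_of_disjoint hd₂, card_union_of_disjoint hd₁,
    card_singleton] at this
  omega

theorem card_le_card_of_toggle_pair {V : Type*} [DecidableEq V]
    (H : Finset (Finset V)) (B : Finset V) (hne : H.Nonempty)
    (hH : ∀ s ∈ H, ∀ v ∈ B, ∃ u, u ≠ v ∧ s ∆ {v, u} ∈ H) : #B ≤ #H := by
  obtain ⟨e, he⟩ := hne
  refine (card_le_card_of_toggle_pair_of_empty_mem (H.image (e ∆ ·)) B ?_ ?_).trans card_image_le
  · exact mem_image.2 ⟨e, he, symmDiff_self e⟩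
  · intro s hs v hv
    obtain ⟨t, ht, rfl⟩ := mem_image.1 hs
    obtain ⟨u, hu, h⟩ := hH t ht v hv
    exact ⟨u, hu, mem_image.2 ⟨_, h, (symmDiff_assoc _ _ _).symm⟩⟩

/-- The weight taking the value `1` on `S` and `2` elsewhere. -/
def weightOf {V : Type*} [DecidableEq V] (S : Finset V) (i : V) : ℕ :=
  if i ∈ S then 1 else 2

theorem weightOf_injective {V : Type*} [DecidableEq V] :
    Function.Injective (weightOf : Finset V → V → ℕ) := by
  intro S T h
  ext i
  have := congrFun h i
  unfold weightOf at this
  grind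

theorem sum_weightOf_add_card_inter {V : Type*} [DecidableEq V] (S e : Finset V) :
    ∑ i ∈ e, weightOf S i + #(S ∩ e) = 2 * #e := by
  rw [inter_comm, ← filter_mem_eq_inter, card_filter, ← sum_add_distrib, mul_comm,
    ← smul_eq_mul, ← sum_const]
  refine sum_congr rfl fun i _ => ?_
  unfold weightOf
  split_ifs <;> rfl

theorem card_symmDiff_add_two_mul_card_inter {V : Type*} [DecidableEq V] (S e : Finset V) :
    #(S ∆ e) + 2 * #(S ∩ e) = #S + #e := by
  have h1 := card_sdiff_add_card_inter S e
  have h2 := card_sdiff_add_card_inter e S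
  rw [inter_comm] at h2
  have h3 : #(S ∆ e) = #(S \ e) + #(e \ S) :=
    card_union_of_disjoint disjoint_sdiff_sdiff
  omega

theorem specialIso_weightOf {V : Type*} [DecidableEq V] {r : ℕ} {H : Finset (Finset V)}
    (hcard : ∀ e ∈ H, #e = r) {S e : Finset V} (he : e ∈ H) (hS : S ⊆ e ∨ e ⊆ S)
    (hlt : ∀ e' ∈ H, e' ≠ e → #(S ∆ e) < #(S ∆ e')) : SpecialIso H (weightOf S) := by
  refine ⟨fun i => ?_, e, he, fun i hi j hj => ?_, fun e' he' hne => ?_⟩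
  · unfold weightOf
    split_ifs <;> simp
  · unfold weightOf
    grind
  · have h1 := sum_weightOf_add_card_inter S e
    have h2 := sum_weightOf_add_card_inter S e'
    have h3 := card_symmDiff_add_two_mul_card_inter S e
    have h4 := card_symmDiff_add_two_mul_card_inter S e'
    have h5 := hlt e' he' hne
    rw [hcard e he] at h1 h3
    rw [hcard e' he'] at h2 h4
    omega

theorem specialIso_weightOf_self {V : Type*} [DecidableEq V] {r : ℕ} {H : Finset (Finset V)}
    (hcard : ∀ e ∈ H, #e = r) {e : Finset V} (he : e ∈ H) : SpecialIso H (weightOf e) := by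
  refine specialIso_weightOf hcard he (Or.inl Subset.rfl) fun e' _ hne => ?_
  rw [symmDiff_self, bot_eq_empty, card_empty, card_pos, nonempty_iff_ne_empty]
  exact fun h => hne (symmDiff_eq_bot.1 h).symm

theorem symmDiff_singleton_symmDiff_singleton {V : Type*} [DecidableEq V] (e : Finset V)
    {u v : V} (h : u ≠ v) : e ∆ {v} ∆ {u} = e ∆ {v, u} := by
  ext i
  simp only [mem_symmDiff, mem_singleton, mem_insert]
  grind

theorem specialIso_weightOf_symmDiff_singleton {V : Type*} [DecidableEq V] {r : ℕ}
    {H : Finset (Finset V)} (hcard : ∀ e ∈ H, #e = r) {e : Finset V} (he : e ∈ H) {v : V}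
    (hv : ∀ u, u ≠ v → e ∆ {v, u} ∉ H) : SpecialIso H (weightOf (e ∆ {v})) := by
  have h1 : #(e ∆ {v} ∆ e) = 1 := by
    rw [symmDiff_comm e, symmDiff_symmDiff_cancel_right, card_singleton]
  refine specialIso_weightOf hcard he ?_ fun e' he' hne => ?_
  · by_cases h : v ∈ e
    · left
      intro i
      simp only [mem_symmDiff, mem_singleton]
      grind
    · right
      intro i
      simp only [mem_symmDiff, mem_singleton]
      grind
  · have h3 := card_symmDiff_add_two_mul_card_inter (e ∆ {v}) e
    have h4 := card_symmDiff_add_two_mul_card_inter (e ∆ {v}) e'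
    rw [hcard e he] at h3
    rw [hcard e' he'] at h4
    have h5 : #(e ∆ {v} ∆ e') ≠ 1 := by
      intro h
      obtain ⟨u, hu⟩ := card_eq_one.1 h
      have h6 : e' = e ∆ {v} ∆ {u} := by rw [← hu, symmDiff_symmDiff_cancel_left]
      obtain rfl | huv := eq_or_ne u v
      · exact hne (h6.trans (symmDiff_symmDiff_cancel_right _ _))
      · rw [symmDiff_singleton_symmDiff_singleton e huv] at h6
        exact hv u huv (h6 ▸ he')
    omega

theorem finite_Zprime {V : Type*} [Finite V] (H : Finset (Finset V)) : (Zprime H).Finite := by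
  refine (Set.Finite.pi fun _ : V => Set.finite_Icc 1 2).subset fun w hw => ?_
  exact fun i _ => hw.1 i

/-- Proposition 18 of the paper.  If `H` is a non-empty hypergraph
on `[n]` all of whose edges have cardinality exactly `r`, then `|Z'(H)| ≥ n`. -/
theorem stmt_14 {n r : ℕ} (H : Finset (Finset (Fin n))) (hne : H.Nonempty)
    (hcard : ∀ e ∈ H, e.card = r) :
    n ≤ (Zprime H).ncard := by
  classical
  set B := (univ : Finset (Fin n)).filter fun v => ∀ e ∈ H, ∃ u, u ≠ v ∧ e ∆ {v, u} ∈ H with hB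
  have hBH : #B ≤ #H := card_le_card_of_toggle_pair H B hne fun s hs v hv =>
    (mem_filter.1 hv).2 s hs
  have hgood : ∀ v, ∃ e, v ∈ Bᶜ → e ∈ H ∧ ∀ u, u ≠ v → e ∆ {v, u} ∉ H := by
    intro v
    by_cases hv : ∀ e ∈ H, ∃ u, u ≠ v ∧ e ∆ {v, u} ∈ H
    · exact ⟨∅, fun h => absurd (mem_filter.2 ⟨mem_univ v, hv⟩) (mem_compl.1 h)⟩
    · push Not at hv
      obtain ⟨e, he⟩ := hv
      exact ⟨e, fun _ => he⟩
  choose E hE using hgood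
  set K := Bᶜ.image fun v => E v ∆ {v}
  have hK : #K = #Bᶜ := by
    refine card_image_of_injOn fun v hv u hu h => ?_
    by_contra hvu
    have h1 : E u = E v ∆ {v} ∆ {u} := by
      rw [show E v ∆ {v} = E u ∆ {u} from h, symmDiff_symmDiff_cancel_right]
    rw [symmDiff_singleton_symmDiff_singleton _ (Ne.symm hvu)] at h1
    exact (hE v hv).2 u (Ne.symm hvu) (h1 ▸ (hE u hu).1)
  have hdisj : Disjoint H K := by
    refine disjoint_left.2 fun s hs hsK => ?_
    obtain ⟨v, hv, rfl⟩ := mem_image.1 hsK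
    have h1 := card_symmDiff_add_two_mul_card_inter (E v) {v}
    rw [hcard _ hs, hcard _ (hE v hv).1, card_singleton] at h1
    omega
  have hsub : (((H ∪ K).image weightOf : Finset (Fin n → ℕ)) : Set (Fin n → ℕ)) ⊆ Zprime H := by
    intro w hw
    obtain ⟨S, hS, rfl⟩ := mem_image.1 (mem_coe.1 hw)
    obtain h | h := mem_union.1 hS
    · exact specialIso_weightOf_self hcard h
    · obtain ⟨v, hv, rfl⟩ := mem_image.1 h
      exact specialIso_weightOf_symmDiff_singleton hcard (hE v hv).1 (hE v hv).2
  have hle := Set.ncard_le_ncard hsub (finite_Zprime H)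
  rw [Set.ncard_coe_finset, card_image_of_injective _ weightOf_injective,
    card_union_of_disjoint hdisj, hK] at hle
  have hcompl := card_add_card_compl B
  rw [Fintype.card_fin] at hcompl
  omega
end

section
/- Let H be a linear inclusion-free hypergraph on [n] (any two distinct edges share at most one vertex), and let f: [M] → ℝ be strictly increasing with positive values. Suppose w: [n] → [M] takes the value 1 at exactly one vertex i, and every min-weight edge of H under w contains i and has cardinality strictly greater than 1. Then for any min-weight edge e of w, the edge e is the unique min-weight edge for the weight g(w,e) = w − χ_{{Next(i,e)}}, where Next(i,e) is the smallest j ∈ e with j > i if such j exists, and otherwise the smallest element of e. -/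
open Finset

/-- The *next vertex* of `i` in the edge `e`: the smallest `j ∈ e` with `j > i` if
one exists, and otherwise the smallest element of `e` (junk value `i` if `e = ∅`). -/
def nextV {n : ℕ} (i : Fin n) (e : Finset (Fin n)) : Fin n :=
  if h : (e.filter fun j => i < j).Nonempty then (e.filter fun j => i < j).min' h
  else if h2 : e.Nonempty then e.min' h2 else i

/-- `H` is a linear hypergraph: any two distinct edges share at most one vertex. -/
def LinearHG {V : Type*} [DecidableEq V] (H : Finset (Finset V)) : Prop :=
  ∀ e ∈ H, ∀ e' ∈ H, e ≠ e' → (e ∩ e').card ≤ 1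

theorem nextV_mem_and_ne {n : ℕ} {i : Fin n} {e : Finset (Fin n)} (hcard : 1 < e.card) :
    nextV i e ∈ e ∧ nextV i e ≠ i := by
  have hne : e.Nonempty := Finset.card_pos.mp (by omega)
  unfold nextV
  by_cases h : (e.filter fun j => i < j).Nonempty
  · rw [dif_pos h]
    have hm := Finset.mem_filter.mp (Finset.min'_mem _ h)
    exact ⟨hm.1, ne_of_gt hm.2⟩
  · rw [dif_neg h, dif_pos hne]
    refine ⟨Finset.min'_mem _ _, ?_⟩
    obtain ⟨j, hj, hji⟩ := Finset.exists_mem_ne hcard i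
    have hlt : j < i := by
      refine lt_of_le_of_ne (not_lt.mp fun hij => h ?_) hji
      exact ⟨j, Finset.mem_filter.mpr ⟨hj, hij⟩⟩
    exact ne_of_lt ((Finset.min'_le e j hj).trans_lt hlt)

/-- Lowering the weight of the single vertex `v` changes an edge weight only if `v` lies on it. -/
theorem edgeW_decrement {V : Type*} [DecidableEq V] (f : ℕ → ℝ) (w : V → ℕ) (v : V)
    (e : Finset V) :
    edgeW f (fun j => if j = v then w j - 1 else w j) e =
      edgeW f w e - if v ∈ e then f (w v) - f (w v - 1) else 0 := by
  rw [eq_sub_iff_add_eq, ← Finset.sum_ite_eq' e v fun j => f (w j) - f (w j - 1)]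
  unfold edgeW
  rw [← Finset.sum_add_distrib]
  refine Finset.sum_congr rfl fun j _ => ?_
  by_cases h : j = v <;> simp [h]

/-- Proposition 21 of the paper.  Let `H` be a linear
inclusion-free hypergraph, `f` an objective function, and `w` a weight taking the
value 1 at exactly one vertex `i`, such that every min-weight edge contains `i` and
has cardinality greater than 1.  Then for any min-weight edge `e`, the edge `e` is
the unique min-weight edge for `g(w,e) = w - χ_{{Next(i,e)}}`. -/
theorem stmt_16 {n M : ℕ} (H : Finset (Finset (Fin n))) (f : ℕ → ℝ)
    (hH : InclFree H) (hlin : LinearHG H) (hf : Objective M f)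
    (w : Fin n → ℕ) (hw : ∀ j, 1 ≤ w j ∧ w j ≤ M)
    (i : Fin n) (hi : w i = 1) (hunique : ∀ j, w j = 1 → j = i)
    (hmins : ∀ e' ∈ H, (∀ e'' ∈ H, edgeW f w e' ≤ edgeW f w e'') → i ∈ e' ∧ 1 < e'.card)
    (e : Finset (Fin n)) (he : e ∈ H)
    (hmin : ∀ e' ∈ H, edgeW f w e ≤ edgeW f w e') :
    ∀ e' ∈ H, e' ≠ e →
      edgeW f (fun j => if j = nextV i e then w j - 1 else w j) e <
        edgeW f (fun j => if j = nextV i e then w j - 1 else w j) e' := by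
  intro e' he' hne
  obtain ⟨hie, hcard⟩ := hmins e he hmin
  obtain ⟨hv, hvi⟩ := nextV_mem_and_ne (i := i) hcard
  rw [edgeW_decrement, edgeW_decrement, if_pos hv]
  generalize nextV i e = v at hv hvi ⊢
  have hwv : w v ≠ 1 := fun h => hvi (hunique v h)
  obtain ⟨h1, hM⟩ := hw v
  have hdrop : f (w v - 1) < f (w v) :=
    hf.1 ⟨by omega, by omega⟩ ⟨h1, hM⟩ (by omega)
  by_cases hv' : v ∈ e'
  · have hlt : edgeW f w e < edgeW f w e' := by
      by_contra! hle
      have hie' := (hmins e' he' fun e'' he'' => hle.trans (hmin e'' he'')).1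
      exact hvi (Finset.card_le_one.mp (hlin e he e' he' hne.symm) v
        (Finset.mem_inter.mpr ⟨hv, hv'⟩) i (Finset.mem_inter.mpr ⟨hie, hie'⟩))
    rw [if_pos hv']
    linarith
  · rw [if_neg hv']
    linarith [hmin e' he']
end
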